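/- arXiv:1701.05909 — 2 statements merged into one kernel-verified Lean document; each statement's English description precedes it below -/
import Mathlib

section
/- For every integer m ≥ 1, writing s = n − 2m, one has (3n − 7s)·Ma_m(P) ≤ 48·(s + 2)·Ma_{m−1}(P). -/
open scoped Classical

noncomputable section

/-- A point of the plane. -/
abbrev Pt : Type := ℝ × ℝ

/-- The closed straight-line segment with endpoints `a` and `b`. -/
def Seg (a b : Pt) : Set Pt := segment ℝ a b

/-- `P` is in general position: no three points of `P` are collinear and
no two points of `P` have the same `x`-coordinate. -/
def GenPos (P : Finset Pt) : Prop :=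
  (∀ p ∈ P, ∀ q ∈ P, ∀ r ∈ P, p ≠ q → q ≠ r → p ≠ r →
      ¬ Collinear ℝ ({p, q, r} : Set Pt)) ∧
  ∀ p ∈ P, ∀ q ∈ P, p ≠ q → p.1 ≠ q.1

/-- `M` is a crossing-free matching of `P`.  Each edge is recorded as an ordered
pair `(left endpoint, right endpoint)`, the left endpoint being the one of
smaller `x`-coordinate.  No point is an endpoint of more than one edge and no
two distinct edges intersect. -/
structure IsMatching (P : Finset Pt) (M : Finset (Pt × Pt)) : Prop where
  left_mem : ∀ e ∈ M, e.1 ∈ P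
  right_mem : ∀ e ∈ M, e.2 ∈ P
  x_lt : ∀ e ∈ M, e.1.1 < e.2.1
  no_shared : ∀ e ∈ M, ∀ f ∈ M, e ≠ f →
      e.1 ≠ f.1 ∧ e.1 ≠ f.2 ∧ e.2 ≠ f.1 ∧ e.2 ≠ f.2
  no_cross : ∀ e ∈ M, ∀ f ∈ M, e ≠ f → Seg e.1 e.2 ∩ Seg f.1 f.2 = ∅

/-- `p` is isolated in `M`: it is an endpoint of no edge of `M`. -/
def Isolated (M : Finset (Pt × Pt)) (p : Pt) : Prop :=
  ∀ e ∈ M, e.1 ≠ p ∧ e.2 ≠ p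

/-- The `y`-coordinate of the point of the line through the endpoints of `e`
having abscissa `x`. -/
def yOn (e : Pt × Pt) (x : ℝ) : ℝ :=
  e.1.2 + (x - e.1.1) * (e.2.2 - e.1.2) / (e.2.1 - e.1.1)

/-- The point of (the line supporting) the edge `e` with the same
`x`-coordinate as `q`. -/
def vproj (e : Pt × Pt) (q : Pt) : Pt := (q.1, yOn e q.1)

/-- `q` is vertically visible from the interior of the edge `e` of `M`:
its `x`-coordinate lies strictly between the `x`-coordinates of the endpoints
of `e`, and the open vertical segment joining `q` to the point of `e` with the
same `x`-coordinate meets no edge of `M` and contains no point of `P`. -/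
def VertVisible (P : Finset Pt) (M : Finset (Pt × Pt)) (q : Pt) (e : Pt × Pt) : Prop :=
  e.1.1 < q.1 ∧ q.1 < e.2.1 ∧
  (∀ f ∈ M, openSegment ℝ q (vproj e q) ∩ Seg f.1 f.2 = ∅) ∧
  ∀ r ∈ P, r ∉ openSegment ℝ q (vproj e q)

/-- `p` is the left endpoint of some edge of `M`. -/
def IsLeftEndpoint (M : Finset (Pt × Pt)) (p : Pt) : Prop := ∃ e ∈ M, e.1 = p

/-- `p` is the right endpoint of some edge of `M`. -/
def IsRightEndpoint (M : Finset (Pt × Pt)) (p : Pt) : Prop := ∃ e ∈ M, e.2 = p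

/-- The rank `d_M(p)` of `p` in `M`. -/
def rank (P : Finset Pt) (M : Finset (Pt × Pt)) (p : Pt) : ℕ :=
  if h : ∃ e ∈ M, e.1 = p then
    (P.filter fun q =>
      (Isolated M q ∨ IsLeftEndpoint M q) ∧ VertVisible P M q h.choose).card
  else if h' : ∃ e ∈ M, e.2 = p then
    (P.filter fun q =>
      (Isolated M q ∨ IsRightEndpoint M q) ∧ VertVisible P M q h'.choose).card
  else 0

/-- The result of inserting the edge `qp` into `M` (oriented left-to-right). -/
def addEdge (M : Finset (Pt × Pt)) (q p : Pt) : Finset (Pt × Pt) :=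
  if q.1 < p.1 then insert (q, p) M else insert (p, q) M

/-- `h_i(p,M)`: the number of points `q ∈ P` such that `M ∪ {qp}` is a
crossing-free matching of `P` in which `p` has rank `i`. -/
def hcount (P : Finset Pt) (M : Finset (Pt × Pt)) (p : Pt) (i : ℕ) : ℕ :=
  (P.filter fun q =>
    IsMatching P (addEdge M q p) ∧ rank P (addEdge M q p) p = i).card

/-- `l_i(p,M)`: the number of points `q ∈ P` to the left of `p` such that
`M ∪ {qp}` is a crossing-free matching of `P` in which `p` has rank `i`. -/
def lcount (P : Finset Pt) (M : Finset (Pt × Pt)) (p : Pt) (i : ℕ) : ℕ :=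
  (P.filter fun q => q.1 < p.1 ∧ IsMatching P (insert (q, p) M) ∧
    rank P (insert (q, p) M) p = i).card

/-- `v_i(M)`: the number of points of `P` of rank `i` in `M`. -/
def vcount (P : Finset Pt) (M : Finset (Pt × Pt)) (i : ℕ) : ℕ :=
  (P.filter fun p => rank P M p = i).card

/-- The (finite) collection of crossing-free matchings of `P` with `m` edges. -/
def Matchings (P : Finset Pt) (m : ℕ) : Finset (Finset (Pt × Pt)) :=
  (P ×ˢ P).powerset.filter fun M => IsMatching P M ∧ M.card = m

/-- `Ma_m(P)`: the number of crossing-free matchings of `P` with `m` edges. -/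
def Ma (P : Finset Pt) (m : ℕ) : ℕ := (Matchings P m).card

/-- `S_k(m)`: the sum of `Σ_{i=0}^{k} (k-i) h_i(p,M')` over all pairs `(p, M')`
with `M'` a crossing-free matching of `P` with `m-1` edges and `p ∈ P`
isolated in `M'`. -/
def Ssum (P : Finset Pt) (k m : ℕ) : ℕ :=
  ∑ M ∈ Matchings P (m - 1), ∑ p ∈ P.filter (fun p => Isolated M p),
    ∑ i ∈ Finset.range (k + 1), (k - i) * hcount P M p i

/-- The union of the edges of `M`, as a subset of the plane. -/
def edgesSet (M : Finset (Pt × Pt)) : Set Pt := ⋃ e ∈ M, Seg e.1 e.2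

/-- The vertical wall of `r`: the maximal open vertical segment through `r`
meeting no edge of `M` except possibly at `r` itself. -/
def Wall (M : Finset (Pt × Pt)) (r : Pt) : Set Pt :=
  {x : Pt | x.1 = r.1 ∧
    ∀ z : Pt, z.1 = r.1 → z.2 ∈ Set.uIcc x.2 r.2 → z ≠ r → z ∉ edgesSet M}

/-- The complement of the union of all edges of `M` and all vertical walls of
points of `P`; its connected components are the cells of the vertical
decomposition. -/
def FreeRegion (P : Finset Pt) (M : Finset (Pt × Pt)) : Set Pt :=
  (edgesSet M ∪ ⋃ r ∈ P, Wall M r)ᶜ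

/-- `T` is a cell of the vertical decomposition of `M`. -/
def IsCell (P : Finset Pt) (M : Finset (Pt × Pt)) (T : Set Pt) : Prop :=
  ∃ x ∈ FreeRegion P M, T = connectedComponentIn (FreeRegion P M) x

/-- `T` is the cell containing the points `(x(p) - ε, y(p))` for all
sufficiently small `ε > 0`. -/
def IsLeftCellOf (P : Finset Pt) (M : Finset (Pt × Pt)) (p : Pt) (T : Set Pt) : Prop :=
  IsCell P M T ∧ ∃ ε₀ > (0 : ℝ), ∀ ε : ℝ, 0 < ε → ε < ε₀ →
    ((p.1 - ε, p.2) : Pt) ∈ T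

/-- `T` is the cell containing the points `(x(p) + ε, y(p))` for all
sufficiently small `ε > 0`. -/
def IsRightCellOf (P : Finset Pt) (M : Finset (Pt × Pt)) (p : Pt) (T : Set Pt) : Prop :=
  IsCell P M T ∧ ∃ ε₀ > (0 : ℝ), ∀ ε : ℝ, 0 < ε → ε < ε₀ →
    ((p.1 + ε, p.2) : Pt) ∈ T

/-- `q` is the left bifurcation point of `p`: part of the boundary of the cell
to the left of `p` lies on the vertical wall of `q`, and `x(q)` is the infimum
of the abscissas of points of that cell. -/
def IsLeftBifPoint (P : Finset Pt) (M : Finset (Pt × Pt)) (p q : Pt) : Prop :=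
  q ∈ P ∧ ∃ T, IsLeftCellOf P M p T ∧ (frontier T ∩ Wall M q).Nonempty ∧
    IsGLB {x : ℝ | ∃ y : ℝ, ((x, y) : Pt) ∈ T} q.1

/-- `q` is the right bifurcation point of `p`. -/
def IsRightBifPoint (P : Finset Pt) (M : Finset (Pt × Pt)) (p q : Pt) : Prop :=
  q ∈ P ∧ ∃ T, IsRightCellOf P M p T ∧ (frontier T ∩ Wall M q).Nonempty ∧
    IsLUB {x : ℝ | ∃ y : ℝ, ((x, y) : Pt) ∈ T} q.1

/-- The edge `e` of `M` is vertically visible below `p`. -/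
def EdgeVisBelow (P : Finset Pt) (M : Finset (Pt × Pt)) (e : Pt × Pt) (p : Pt) : Prop :=
  e.1.1 < p.1 ∧ p.1 < e.2.1 ∧ yOn e p.1 < p.2 ∧
  (∀ f ∈ M, openSegment ℝ p (vproj e p) ∩ Seg f.1 f.2 = ∅) ∧
  ∀ r ∈ P, r ∉ openSegment ℝ p (vproj e p)

/-- The edge `e` of `M` is vertically visible above `p`. -/
def EdgeVisAbove (P : Finset Pt) (M : Finset (Pt × Pt)) (e : Pt × Pt) (p : Pt) : Prop :=
  e.1.1 < p.1 ∧ p.1 < e.2.1 ∧ p.2 < yOn e p.1 ∧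
  (∀ f ∈ M, openSegment ℝ p (vproj e p) ∩ Seg f.1 f.2 = ∅) ∧
  ∀ r ∈ P, r ∉ openSegment ℝ p (vproj e p)

end

theorem yOn_mem_seg (e : Pt × Pt) (h : e.1.1 < e.2.1) (t : ℝ) (h1 : e.1.1 ≤ t)
    (h2 : t ≤ e.2.1) : ((t, yOn e t) : Pt) ∈ Seg e.1 e.2 := by
  have hd : 0 < e.2.1 - e.1.1 := by linarith
  refine ⟨(e.2.1 - t) / (e.2.1 - e.1.1), (t - e.1.1) / (e.2.1 - e.1.1), ?_, ?_, ?_, ?_⟩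
  · exact div_nonneg (by linarith) hd.le
  · exact div_nonneg (by linarith) hd.le
  · field_simp; ring
  · ext
    · simp; field_simp; ring
    · simp [yOn]; field_simp; ring

theorem yOn_left (e : Pt × Pt) : yOn e e.1.1 = e.1.2 := by simp [yOn]

theorem yOn_collinear (p q r : Pt) (h : p.1 < q.1) (hr : r.2 = yOn (p, q) r.1) :
    Collinear ℝ ({p, q, r} : Set Pt) := by
  rw [collinear_iff_of_mem (p₀ := p) (by simp)]
  have hd : q.1 - p.1 ≠ 0 := by linarith
  refine ⟨q - p, ?_⟩
  intro x hx
  simp only [Set.mem_insert_iff, Set.mem_singleton_iff] at hx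
  rcases hx with rfl | rfl | rfl
  · exact ⟨0, by simp⟩
  · exact ⟨1, by simp⟩
  · refine ⟨(x.1 - p.1) / (q.1 - p.1), ?_⟩
    ext
    · simp; field_simp; ring
    · simp [hr, yOn]; field_simp; ring

theorem yOn_cont (e : Pt × Pt) : Continuous (yOn e) := by
  unfold yOn; fun_prop

theorem yOn_ivt (e f : Pt × Pt) (a b : ℝ) (hab : a ≤ b) (h1 : yOn e a ≤ yOn f a)
    (h2 : yOn f b ≤ yOn e b) : ∃ t, a ≤ t ∧ t ≤ b ∧ yOn e t = yOn f t := by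
  have hc : ContinuousOn (fun t => yOn e t - yOn f t) (Set.Icc a b) :=
    ((yOn_cont e).sub (yOn_cont f)).continuousOn
  have := intermediate_value_Icc hab hc
  obtain ⟨t, ht, h⟩ := this (show (0:ℝ) ∈ _ from ⟨by simp; linarith, by simp; linarith⟩)
  exact ⟨t, ht.1, ht.2, by simp at h; linarith⟩

/-- No edge of `M` passes strictly between heights `y` and `z` at abscissa `t`. -/
def NB (M : Finset (Pt × Pt)) (y z t : ℝ) : Prop :=
  ∀ f ∈ M, f.1.1 ≤ t → t ≤ f.2.1 → ¬ (y < yOn f t ∧ yOn f t < z)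

noncomputable def Dg (P : Finset Pt) (M : Finset (Pt × Pt)) (p q : Pt) : Finset Pt :=
  P.filter fun r => p.1 < r.1 ∧ r.1 < q.1 ∧ (∀ f ∈ M, f.2 ≠ r) ∧
    NB M r.2 (yOn (p, q) r.1) r.1 ∧ NB M (yOn (p, q) r.1) r.2 r.1

def Good (P : Finset Pt) (M : Finset (Pt × Pt)) (p q : Pt) : Prop :=
  q ∈ P ∧ p.1 < q.1 ∧ (∀ f ∈ M, f.1 ≠ q ∧ f.2 ≠ q) ∧
  (∀ f ∈ M, ∀ t, p.1 ≤ t → t ≤ q.1 → f.1.1 ≤ t → t ≤ f.2.1 → yOn (p, q) t ≠ yOn f t)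

def Fb : ℕ → ℕ
  | 0 => 0
  | k + 1 => max (k + 1 + Fb k) (2 * Fb k)

theorem sweep (P : Finset Pt) (M : Finset (Pt × Pt)) (p q q' : Pt)
    (hq : Good P M p q) (hq' : Good P M p q') (t t' : ℝ) (hp : p.1 ≤ t) (htt : t ≤ t')
    (h1 : t' ≤ q.1) (h2 : t' ≤ q'.1)
    (hv : NB M (yOn (p, q) t) (yOn (p, q') t) t)
    (f : Pt × Pt) (hf : f ∈ M) (ha : f.1.1 ≤ t') (hb : t' ≤ f.2.1)
    (hl : yOn (p, q) t' < yOn f t') (hr : yOn f t' < yOn (p, q') t') :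
    t < f.1.1 ∧ yOn (p, q) f.1.1 < f.1.2 ∧ f.1.2 < yOn (p, q') f.1.1 := by
  have gen : ∀ u, t ≤ u → u ≤ t' → f.1.1 ≤ u →
      yOn (p, q) u < yOn f u ∧ yOn f u < yOn (p, q') u := by
    intro u hu hu' hfu
    constructor
    · by_contra hc
      push Not at hc
      obtain ⟨v, v1, v2, v3⟩ := yOn_ivt f (p, q) u t' hu' hc hl.le
      exact hq.2.2.2 f hf v (by linarith) (by linarith) (by linarith) (by linarith) v3.symm
    · by_contra hc
      push Not at hc
      obtain ⟨v, v1, v2, v3⟩ := yOn_ivt (p, q') f u t' hu' hc hr.le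
      exact hq'.2.2.2 f hf v (by linarith) (by linarith) (by linarith) (by linarith) v3
  have hlt : t < f.1.1 := by
    by_contra hc
    push Not at hc
    exact hv f hf hc (by linarith) (gen t le_rfl htt hc)
  have := gen f.1.1 hlt.le ha le_rfl
  rw [yOn_left] at this
  exact ⟨hlt, this⟩

theorem key (P : Finset Pt) (hP : GenPos P) (M : Finset (Pt × Pt)) (hM : IsMatching P M)
    (p : Pt) (hpP : p ∈ P) (k : ℕ) :
    ∀ (t : ℝ) (A : Finset Pt), p.1 ≤ t → (∀ q ∈ A, t < q.1) → (∀ q ∈ A, Good P M p q) →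
      (∀ q ∈ A, ∀ q' ∈ A, NB M (yOn (p, q) t) (yOn (p, q') t) t) →
      ∑ q ∈ A, (k - ((Dg P M p q).filter (fun r => t < r.1)).card) ≤ Fb k := by
  induction k with
  | zero => intro t A _ _ _ _; simp [Fb]
  | succ k ih =>
    intro t A hpt htA hG hV
    rcases A.eq_empty_or_nonempty with rfl | hne
    · simp
    set C : Finset Pt := A ∪ P.filter (fun r => t < r.1 ∧ (∃ f ∈ M, f.1 = r) ∧
      ∃ q ∈ A, ∃ q' ∈ A, yOn (p, q) r.1 < r.2 ∧ r.2 < yOn (p, q') r.1) with hC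
    obtain ⟨r, hrC, hmin⟩ := C.exists_min_image (fun r => r.1)
      (hne.mono Finset.subset_union_left)
    have hrA : ∀ q ∈ A, r.1 ≤ q.1 := fun q hq => hmin q (Finset.mem_union_left _ hq)
    have htr : t < r.1 := by
      rcases Finset.mem_union.1 hrC with h | h
      · exact htA r h
      · exact (Finset.mem_filter.1 h).2.1
    have hrP : r ∈ P := by
      rcases Finset.mem_union.1 hrC with h | h
      · exact (hG r h).1
      · exact (Finset.mem_filter.1 h).1
    -- edges strictly between members at r.1 start at r
    have hstart : ∀ q ∈ A, ∀ q' ∈ A, ∀ f ∈ M, f.1.1 ≤ r.1 → r.1 ≤ f.2.1 →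
        yOn (p, q) r.1 < yOn f r.1 → yOn f r.1 < yOn (p, q') r.1 → f.1 = r := by
      intro q hq q' hq' f hf h1 h2 h3 h4
      have hs := sweep P M p q q' (hG q hq) (hG q' hq') t r.1 hpt htr.le (hrA q hq)
        (hrA q' hq') (hV q hq q' hq') f hf h1 h2 h3 h4
      have hfC : f.1 ∈ C := by
        apply Finset.mem_union_right
        rw [Finset.mem_filter]
        exact ⟨hM.left_mem f hf, hs.1, ⟨f, hf, rfl⟩, q, hq, q', hq', hs.2⟩
      have := hmin _ hfC
      by_contra hne'
      exact hP.2 f.1 (hM.left_mem f hf) r hrP hne' (le_antisymm h1 this)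
    have hlt : ∀ q ∈ A, q ≠ r → r.1 < q.1 := fun q hq hqr =>
      lt_of_le_of_ne (hrA q hq) (hP.2 r hrP q (hG q hq).1 (Ne.symm hqr))
    have hstep : ∀ q ∈ A, q ≠ r → r ∈ Dg P M p q →
        k + 1 - ((Dg P M p q).filter (fun x => t < x.1)).card ≤
        k - ((Dg P M p q).filter (fun x => r.1 < x.1)).card := by
      intro q hq hqr hr
      have : ((Dg P M p q).filter (fun x => r.1 < x.1)).card <
          ((Dg P M p q).filter (fun x => t < x.1)).card := by
        apply Finset.card_lt_card
        rw [Finset.ssubset_iff_of_subset]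
        · exact ⟨r, by simp [hr, htr], by simp⟩
        · intro x hx
          simp only [Finset.mem_filter] at hx ⊢
          exact ⟨hx.1, htr.trans hx.2⟩
      omega
    by_cases hrA' : r ∈ A
    · have hnor := (hG r hrA').2.2.1
      have hyr : yOn (p, r) r.1 = r.2 := by
        have : r.1 - p.1 ≠ 0 := by have := (hG r hrA').2.1; linarith
        simp [yOn]; field_simp; ring
      have hVr : ∀ q ∈ A, ∀ q' ∈ A, NB M (yOn (p, q) r.1) (yOn (p, q') r.1) r.1 := by
        intro q hq q' hq' f hf h1 h2 h3
        exact (hnor f hf).1 (hstart q hq q' hq' f hf h1 h2 h3.1 h3.2)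
      rw [← Finset.add_sum_erase _ _ hrA']
      have h1 : ∑ q ∈ A.erase r, (k + 1 - ((Dg P M p q).filter (fun x => t < x.1)).card) ≤
          ∑ q ∈ A.erase r, (k - ((Dg P M p q).filter (fun x => r.1 < x.1)).card) := by
        apply Finset.sum_le_sum
        intro q hq
        have hq2 := Finset.mem_of_mem_erase hq
        have hqr := Finset.ne_of_mem_erase hq
        apply hstep q hq2 hqr
        simp only [Dg, Finset.mem_filter]
        refine ⟨hrP, (hG r hrA').2.1, hlt q hq2 hqr, fun f hf => (hnor f hf).2, ?_, ?_⟩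
        · have := hVr r hrA' q hq2; rwa [hyr] at this
        · have := hVr q hq2 r hrA'; rwa [hyr] at this
      have h2 := ih r.1 (A.erase r) (hpt.trans htr.le)
        (fun q hq => hlt q (Finset.mem_of_mem_erase hq) (Finset.ne_of_mem_erase hq))
        (fun q hq => hG q (Finset.mem_of_mem_erase hq))
        (fun q hq q' hq' => hVr q (Finset.mem_of_mem_erase hq) q' (Finset.mem_of_mem_erase hq'))
      have h3 : k + 1 + Fb k ≤ Fb (k + 1) := le_max_left _ _
      omega
    · have hr2 : r ∈ P.filter (fun r => t < r.1 ∧ (∃ f ∈ M, f.1 = r) ∧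
        ∃ q ∈ A, ∃ q' ∈ A, yOn (p, q) r.1 < r.2 ∧ r.2 < yOn (p, q') r.1) := by
        rcases Finset.mem_union.1 hrC with h | h
        · exact absurd h hrA'
        · exact h
      obtain ⟨-, -, ⟨g, hg, hgr⟩, q0, hq0, q1, hq1, hlo, hhi⟩ := Finset.mem_filter.1 hr2
      have hner : ∀ q ∈ A, q ≠ r := fun q hq h => hrA' (h ▸ hq)
      have hnr : ∀ f ∈ M, f.2 ≠ r := by
        intro f hf h
        by_cases hfg : f = g
        · subst hfg
          have := hM.x_lt f hf
          rw [h, hgr] at this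
          exact lt_irrefl _ this
        · exact (hM.no_shared f hf g hg hfg).2.2.1 (h.trans hgr.symm)
      have hyf : ∀ f ∈ M, f.1 = r → yOn f r.1 = r.2 := by
        intro f hf h; rw [← h, yOn_left]
      have hncol : ∀ q ∈ A, r.2 ≠ yOn (p, q) r.1 := by
        intro q hq h
        have hpr : p ≠ r := by rintro rfl; linarith
        have hpq : p ≠ q := by rintro rfl; exact lt_irrefl _ (hG p hq).2.1
        exact hP.1 p hpP q (hG q hq).1 r hrP hpq (hner q hq) hpr
          (yOn_collinear p q r (hG q hq).2.1 h)
      have hD : ∀ q ∈ A, r ∈ Dg P M p q := by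
        intro q hq
        simp only [Dg, Finset.mem_filter]
        refine ⟨hrP, by linarith, hlt q hq (hner q hq), hnr, ?_, ?_⟩
        · intro f hf h1 h2 h3
          have := hstart q0 hq0 q hq f hf h1 h2 (hlo.trans h3.1) h3.2
          have := hyf f hf this
          linarith
        · intro f hf h1 h2 h3
          have := hstart q hq q1 hq1 f hf h1 h2 h3.1 (h3.2.trans hhi)
          have := hyf f hf this
          linarith
      have h1 : ∑ q ∈ A, (k + 1 - ((Dg P M p q).filter (fun x => t < x.1)).card) ≤
          ∑ q ∈ A, (k - ((Dg P M p q).filter (fun x => r.1 < x.1)).card) :=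
        Finset.sum_le_sum fun q hq => hstep q hq (hner q hq) (hD q hq)
      have h1' := Finset.sum_filter_add_sum_filter_not A (fun q => r.2 < yOn (p, q) r.1)
        (fun q => k - ((Dg P M p q).filter (fun x => r.1 < x.1)).card)
      have h2 := ih r.1 (A.filter (fun q => r.2 < yOn (p, q) r.1)) (hpt.trans htr.le)
        (fun q hq => hlt q (Finset.mem_filter.1 hq).1 (hner q (Finset.mem_filter.1 hq).1))
        (fun q hq => hG q (Finset.mem_filter.1 hq).1) (by
          intro q hq q' hq' f hf a1 a2 a3
          rw [Finset.mem_filter] at hq hq'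
          have := hyf f hf (hstart q hq.1 q' hq'.1 f hf a1 a2 a3.1 a3.2)
          linarith [hq.2])
      have h3 := ih r.1 (A.filter (fun q => ¬ r.2 < yOn (p, q) r.1)) (hpt.trans htr.le)
        (fun q hq => hlt q (Finset.mem_filter.1 hq).1 (hner q (Finset.mem_filter.1 hq).1))
        (fun q hq => hG q (Finset.mem_filter.1 hq).1) (by
          intro q hq q' hq' f hf a1 a2 a3
          rw [Finset.mem_filter] at hq hq'
          have := hyf f hf (hstart q hq.1 q' hq'.1 f hf a1 a2 a3.1 a3.2)
          linarith [hq'.2])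
      have h4 : 2 * Fb k ≤ Fb (k + 1) := le_max_right _ _
      omega

theorem key5 (P : Finset Pt) (hP : GenPos P) (M : Finset (Pt × Pt)) (hM : IsMatching P M)
    (p : Pt) (hpP : p ∈ P) (A : Finset Pt) (hG : ∀ q ∈ A, Good P M p q) :
    ∑ q ∈ A, (5 - (Dg P M p q).card) ≤ 24 := by
  have h := key P hP M hM p hpP 5 p.1 A le_rfl (fun q hq => (hG q hq).2.1) hG (by
    intro q _ q' _ f _ _ _ h
    simp only [yOn, sub_self, zero_mul, zero_div, add_zero] at h
    linarith [h.1, h.2])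
  have h5 : Fb 5 = 24 := by decide
  rw [h5] at h
  refine le_trans (Finset.sum_le_sum fun q _ => ?_) h
  have := Finset.card_filter_le (Dg P M p q) (fun r => p.1 < r.1)
  omega

/-- counting visibility pairs -/
theorem sum_Dg (P : Finset Pt) (hP : GenPos P) (M : Finset (Pt × Pt)) (hM : IsMatching P M) :
    ∑ e ∈ M, (Dg P (M.erase e) e.1 e.2).card ≤ 2 * (P.card - M.card) := by
  have hR : (P \ M.image Prod.snd).card = P.card - M.card := by
    rw [Finset.card_sdiff_of_subset, Finset.card_image_of_injOn]
    · intro e he f hf h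
      by_contra hne
      exact (hM.no_shared e he f hf hne).2.2.2 h
    · intro x hx
      obtain ⟨e, he, rfl⟩ := Finset.mem_image.1 hx
      exact hM.right_mem e he
  have hsub : ∀ e ∈ M, Dg P (M.erase e) e.1 e.2 ⊆ P \ M.image Prod.snd := by
    intro e he r hr
    simp only [Dg, Finset.mem_filter] at hr
    rw [Finset.mem_sdiff]
    refine ⟨hr.1, fun h => ?_⟩
    obtain ⟨f, hf, hfr⟩ := Finset.mem_image.1 h
    by_cases hfe : f = e
    · subst hfe
      have := hr.2.2.1
      rw [← hfr] at this
      exact lt_irrefl _ this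
    · exact hr.2.2.2.1 f (Finset.mem_erase.2 ⟨hfe, hf⟩) hfr
  have hc : ∑ e ∈ M, (Dg P (M.erase e) e.1 e.2).card =
      ∑ r ∈ P \ M.image Prod.snd, (M.filter fun e => r ∈ Dg P (M.erase e) e.1 e.2).card := by
    have := Finset.sum_card_bipartiteAbove_eq_sum_card_bipartiteBelow
      (s := M) (t := P \ M.image Prod.snd) (fun e r => r ∈ Dg P (M.erase e) e.1 e.2)
    rw [← Finset.sum_congr rfl fun e he => ?_] at this
    · exact this
    · congr 1
      ext r
      simp only [Finset.bipartiteAbove, Finset.mem_filter]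
      exact ⟨fun h => ⟨hsub e he h, h⟩, fun h => h.2⟩
  rw [hc, ← hR, mul_comm, ← smul_eq_mul]
  apply Finset.sum_le_card_nsmul
  intro r hr
  have hrP : r ∈ P := (Finset.mem_sdiff.1 hr).1
  set S := M.filter fun e => r ∈ Dg P (M.erase e) e.1 e.2 with hS
  have hne : ∀ e ∈ S, r.2 ≠ yOn e r.1 := by
    intro e he h
    rw [hS, Finset.mem_filter] at he
    have hd := he.2
    simp only [Dg, Finset.mem_filter] at hd
    have h1 : e.1 ≠ e.2 := fun h => by have := hM.x_lt e he.1; rw [h] at this; exact lt_irrefl _ this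
    have h2 : e.2 ≠ r := fun h => by have := hd.2.2.1; rw [h] at this; exact lt_irrefl _ this
    have h3 : e.1 ≠ r := fun h => by have := hd.2.1; rw [h] at this; exact lt_irrefl _ this
    exact hP.1 e.1 (hM.left_mem e he.1) e.2 (hM.right_mem e he.1) r hrP h1 h2 h3
      (yOn_collinear _ _ _ (hM.x_lt e he.1) h)
  have heq : ∀ e ∈ S, ∀ f ∈ S, yOn e r.1 = yOn f r.1 → e = f := by
    intro e he f hf h
    rw [hS, Finset.mem_filter] at he hf
    have hd := he.2
    have hd' := hf.2
    simp only [Dg, Finset.mem_filter] at hd hd'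
    by_contra hef
    have := hM.no_cross e he.1 f hf.1 hef
    have h1 := yOn_mem_seg e (hM.x_lt e he.1) r.1 hd.2.1.le hd.2.2.1.le
    have h2 := yOn_mem_seg f (hM.x_lt f hf.1) r.1 hd'.2.1.le hd'.2.2.1.le
    rw [← h] at h2
    have h3 : ((r.1, yOn e r.1) : Pt) ∈ Seg e.1 e.2 ∩ Seg f.1 f.2 := ⟨h1, h2⟩
    rw [this] at h3
    exact h3
  have hnb : ∀ e ∈ S, ∀ f ∈ S, e ≠ f →
      ¬ (r.2 < yOn f r.1 ∧ yOn f r.1 < yOn e r.1) ∧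
      ¬ (yOn e r.1 < yOn f r.1 ∧ yOn f r.1 < r.2) := by
    intro e he f hf hef
    rw [hS, Finset.mem_filter] at he hf
    have hd := he.2
    have hd' := hf.2
    simp only [Dg, Finset.mem_filter] at hd hd'
    have hfe := Finset.mem_erase.2 ⟨Ne.symm hef, hf.1⟩
    exact ⟨hd.2.2.2.2.1 f hfe hd'.2.1.le hd'.2.2.1.le, hd.2.2.2.2.2 f hfe hd'.2.1.le hd'.2.2.1.le⟩
  rw [← Finset.card_filter_add_card_filter_not (s := S) (fun e => r.2 < yOn e r.1)]
  have hup : (S.filter fun e => r.2 < yOn e r.1).card ≤ 1 := by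
    rw [Finset.card_le_one]
    intro e he f hf
    rw [Finset.mem_filter] at he hf
    by_contra hef
    have a1 := (hnb e he.1 f hf.1 hef).1
    have a2 := (hnb f hf.1 e he.1 (Ne.symm hef)).1
    push Not at a1 a2
    exact hef (heq e he.1 f hf.1 (le_antisymm (a1 hf.2) (a2 he.2)))
  have hdn : (S.filter fun e => ¬ r.2 < yOn e r.1).card ≤ 1 := by
    rw [Finset.card_le_one]
    intro e he f hf
    rw [Finset.mem_filter] at he hf
    have he2 := lt_of_le_of_ne (not_lt.1 he.2) (Ne.symm (hne e he.1))
    have hf2 := lt_of_le_of_ne (not_lt.1 hf.2) (Ne.symm (hne f hf.1))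
    apply heq e he.1 f hf.1
    by_contra hy
    have hef : e ≠ f := fun h => hy (by rw [h])
    rcases lt_or_gt_of_ne hy with h | h
    · exact (hnb e he.1 f hf.1 hef).2 ⟨h, hf2⟩
    · exact (hnb f hf.1 e he.1 (Ne.symm hef)).2 ⟨h, he2⟩
  omega

theorem card_iso (P : Finset Pt) (M : Finset (Pt × Pt)) (hM : IsMatching P M) :
    (P.filter (fun p => Isolated M p)).card + 2 * M.card = P.card := by
  have e1 : (M.image Prod.fst).card = M.card := by
    apply Finset.card_image_of_injOn
    intro e he f hf h
    by_contra hne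
    exact (hM.no_shared e he f hf hne).1 h
  have e2 : (M.image Prod.snd).card = M.card := by
    apply Finset.card_image_of_injOn
    intro e he f hf h
    by_contra hne
    exact (hM.no_shared e he f hf hne).2.2.2 h
  have hd : Disjoint (M.image Prod.fst) (M.image Prod.snd) := by
    rw [Finset.disjoint_left]
    intro x hx hy
    obtain ⟨e, he, rfl⟩ := Finset.mem_image.1 hx
    obtain ⟨f, hf, h⟩ := Finset.mem_image.1 hy
    by_cases hef : e = f
    · subst hef
      have := hM.x_lt e he
      rw [h] at this
      exact lt_irrefl _ this
    · exact (hM.no_shared e he f hf hef).2.1 h.symm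
  have hs : M.image Prod.fst ∪ M.image Prod.snd ⊆ P := by
    intro x hx
    rcases Finset.mem_union.1 hx with h | h
    · obtain ⟨e, he, rfl⟩ := Finset.mem_image.1 h; exact hM.left_mem e he
    · obtain ⟨e, he, rfl⟩ := Finset.mem_image.1 h; exact hM.right_mem e he
  have hf : P.filter (fun p => Isolated M p) = P \ (M.image Prod.fst ∪ M.image Prod.snd) := by
    ext x
    rw [Finset.mem_filter, Finset.mem_sdiff, Finset.mem_union, Finset.mem_image, Finset.mem_image]
    apply and_congr_right
    intro _
    unfold Isolated
    constructor
    · rintro h (⟨e, he, hx⟩ | ⟨e, he, hx⟩)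
      · exact (h e he).1 hx
      · exact (h e he).2 hx
    · intro h e he
      exact ⟨fun hx => h (Or.inl ⟨e, he, hx⟩), fun hx => h (Or.inr ⟨e, he, hx⟩)⟩
  have hcard := Finset.card_le_card hs
  rw [hf, Finset.card_sdiff_of_subset hs]
  rw [Finset.card_union_of_disjoint hd, e1, e2] at hcard ⊢
  omega

theorem erase_matching (P : Finset Pt) (M : Finset (Pt × Pt)) (hM : IsMatching P M)
    (e : Pt × Pt) : IsMatching P (M.erase e) := by
  have h : ∀ f ∈ M.erase e, f ∈ M := fun f hf => Finset.mem_of_mem_erase hf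
  exact ⟨fun f hf => hM.left_mem f (h f hf), fun f hf => hM.right_mem f (h f hf),
    fun f hf => hM.x_lt f (h f hf), fun f hf g hg => hM.no_shared f (h f hf) g (h g hg),
    fun f hf g hg => hM.no_cross f (h f hf) g (h g hg)⟩

theorem good_of_erase (P : Finset Pt) (M : Finset (Pt × Pt)) (hM : IsMatching P M)
    (e : Pt × Pt) (he : e ∈ M) :
    Isolated (M.erase e) e.1 ∧ Good P (M.erase e) e.1 e.2 := by
  refine ⟨fun f hf => ?_, hM.right_mem e he, hM.x_lt e he, fun f hf => ?_, ?_⟩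
  · have h := hM.no_shared f (Finset.mem_of_mem_erase hf) e he (Finset.ne_of_mem_erase hf)
    exact ⟨h.1, h.2.2.1⟩
  · have h := hM.no_shared f (Finset.mem_of_mem_erase hf) e he (Finset.ne_of_mem_erase hf)
    exact ⟨h.2.1, h.2.2.2⟩
  · intro f hf t h1 h2 h3 h4 h
    have hfM := Finset.mem_of_mem_erase hf
    have := hM.no_cross e he f hfM (Ne.symm (Finset.ne_of_mem_erase hf))
    have m1 := yOn_mem_seg e (hM.x_lt e he) t h1 h2
    have m2 := yOn_mem_seg f (hM.x_lt f hfM) t h3 h4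
    have h' : yOn e t = yOn f t := h
    rw [← h'] at m2
    have h3 : ((t, yOn e t) : Pt) ∈ Seg e.1 e.2 ∩ Seg f.1 f.2 := ⟨m1, m2⟩
    rw [this] at h3
    exact h3

theorem mem_Matchings (P : Finset Pt) (m : ℕ) (M : Finset (Pt × Pt)) :
    M ∈ Matchings P m ↔ IsMatching P M ∧ M.card = m := by
  unfold Matchings
  rw [Finset.mem_filter, Finset.mem_powerset]
  refine ⟨fun h => h.2, fun h => ⟨fun e he => ?_, h⟩⟩
  exact Finset.mem_product.2 ⟨h.1.left_mem e he, h.1.right_mem e he⟩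

theorem upper (P : Finset Pt) (hP : GenPos P) (m : ℕ) :
    ∑ M ∈ Matchings P m, ∑ e ∈ M, (5 - (Dg P (M.erase e) e.1 e.2).card) ≤
      ∑ M' ∈ Matchings P (m - 1), (P.filter (fun p => Isolated M' p)).card * 24 := by
  have h1 : ∀ M' ∈ Matchings P (m - 1),
      ∑ p ∈ P.filter (fun p => Isolated M' p), ∑ q ∈ P.filter (fun q => Good P M' p q),
        (5 - (Dg P M' p q).card) ≤ (P.filter (fun p => Isolated M' p)).card * 24 := by
    intro M' hM'
    rw [← smul_eq_mul]
    apply Finset.sum_le_card_nsmul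
    intro p hp
    rw [mem_Matchings] at hM'
    exact key5 P hP M' hM'.1 p (Finset.mem_filter.1 hp).1 _ fun q hq => (Finset.mem_filter.1 hq).2
  refine le_trans ?_ (Finset.sum_le_sum h1)
  simp_rw [Finset.sum_sigma']
  let φ : ((_ : Finset (Pt × Pt)) × (Pt × Pt)) → ((_ : Finset (Pt × Pt)) × ((_ : Pt) × Pt)) :=
    fun x => ⟨x.1.erase x.2, ⟨x.2.1, x.2.2⟩⟩
  have hinj : Set.InjOn φ ((Matchings P m).sigma fun M => M) := by
    rintro ⟨M, e⟩ hx ⟨N, f⟩ hy h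
    simp only [Finset.coe_sigma, Set.mem_sigma_iff, Finset.mem_coe] at hx hy
    simp only [φ, Sigma.mk.injEq, heq_eq_eq] at h
    obtain ⟨a, b, c⟩ := h
    have hef : e = f := Prod.ext b c
    subst hef
    have : M = N := by rw [← Finset.insert_erase hx.2, ← Finset.insert_erase hy.2, a]
    subst this
    rfl
  refine le_trans (le_of_eq ?_) (Finset.sum_le_sum_of_subset (s := ((Matchings P m).sigma fun M => M).image φ) ?_)
  · rw [Finset.sum_image hinj]
  · intro y hy
    obtain ⟨⟨M, e⟩, hx, rfl⟩ := Finset.mem_image.1 hy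
    rw [Finset.mem_sigma] at hx
    obtain ⟨hM, he⟩ := hx
    rw [mem_Matchings] at hM
    have hg := good_of_erase P M hM.1 e he
    simp only [φ, Finset.mem_sigma, Finset.mem_filter, mem_Matchings]
    refine ⟨⟨erase_matching P M hM.1 e, ?_⟩, ⟨hM.1.left_mem e he, hg.1⟩, hg.2.1, hg.2⟩
    rw [Finset.card_erase_of_mem he, hM.2]

theorem Ma_recurrence_five (P : Finset Pt) (hP : GenPos P) (m : ℕ) (hm : 1 ≤ m) :
    (3 * (P.card : ℤ) - 7 * ((P.card : ℤ) - 2 * m)) * Ma P m ≤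
      48 * (((P.card : ℤ) - 2 * m) + 2) * Ma P (m - 1) := by
  have hU := upper P hP m
  have hL : ∀ M ∈ Matchings P m, (7 * (m : ℤ) - 2 * P.card) ≤
      ((∑ e ∈ M, (5 - (Dg P (M.erase e) e.1 e.2).card) : ℕ) : ℤ) := by
    intro M hM
    rw [mem_Matchings] at hM
    have h1 := sum_Dg P hP M hM.1
    have h2 := card_iso P M hM.1
    have h3 : ∑ e ∈ M, 5 ≤ ∑ e ∈ M, (5 - (Dg P (M.erase e) e.1 e.2).card) +
        ∑ e ∈ M, (Dg P (M.erase e) e.1 e.2).card := by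
      rw [← Finset.sum_add_distrib]
      apply Finset.sum_le_sum
      intro e _
      omega
    rw [Finset.sum_const, smul_eq_mul, hM.2] at h3
    rw [hM.2] at h1 h2
    omega
  have hS := Finset.sum_le_sum hL
  rw [Finset.sum_const, nsmul_eq_mul, ← Nat.cast_sum] at hS
  have hR : ((∑ M' ∈ Matchings P (m - 1), (P.filter (fun p => Isolated M' p)).card * 24 : ℕ) : ℤ)
      = Ma P (m - 1) * (24 * ((P.card : ℤ) - 2 * m + 2)) := by
    rw [Nat.cast_sum]
    unfold Ma
    rw [← nsmul_eq_mul, ← Finset.sum_const]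
    apply Finset.sum_congr rfl
    intro M hM
    rw [mem_Matchings] at hM
    have h2 := card_iso P M hM.1
    rw [hM.2] at h2
    push_cast
    omega
  have hU' : ((∑ M ∈ Matchings P m, ∑ e ∈ M, (5 - (Dg P (M.erase e) e.1 e.2).card) : ℕ) : ℤ) ≤ _ :=
    Nat.cast_le.2 hU
  rw [hR] at hU'
  have hfin := hS.trans hU'
  change (Ma P m : ℤ) * _ ≤ _ at hfin
  linarith
end

section
/- For every integer m ≥ 1, writing s = n − 2m, one has (3n − 7s)·Ma_m(P) ≤ (89/2)·(s + 2)·Ma_{m−1}(P). -/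
open scoped Classical

structure Cfg (V ι : Type) where
  P : Finset V
  E : Finset ι
  X : V → ℝ
  lo : ι → V
  hi : ι → V
  S : V → V → ι → Prop
  ab : V → ι → Prop
  Free : V → V → Prop
  inj : ∀ u ∈ P, ∀ v ∈ P, X u = X v → u = v
  loP : ∀ e ∈ E, lo e ∈ P
  hiP : ∀ e ∈ E, hi e ∈ P
  lolo : ∀ e ∈ E, ∀ f ∈ E, lo e = lo f → e = f
  hihi : ∀ e ∈ E, ∀ f ∈ E, hi e = hi f → e = f
  freeL : ∀ a b, Free a b → a ∈ P ∧ ∀ e ∈ E, lo e ≠ a ∧ hi e ≠ a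
  freeR : ∀ a b, Free a b → b ∈ P ∧ ∀ e ∈ E, lo e ≠ b ∧ hi e ≠ b
  freeLt : ∀ a b, Free a b → X a < X b
  A1l : ∀ a b, Free a b → ∀ f ∈ E, X (lo f) < X a → X a < X (hi f) → (S a b f ↔ ab a f)
  A1r : ∀ a b, Free a b → ∀ f ∈ E, X (lo f) < X b → X b < X (hi f) → (S a b f ↔ ab b f)
  A2 : ∀ a b, Free a b → ∀ e ∈ E, ∀ f ∈ E, ∀ r, (lo e = r ∨ hi e = r) →
    X a < X r → X r < X b → X (lo f) < X r → X r < X (hi f) →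
    (S a b f ↔ ¬ ab r f) → (S a b e ↔ S a b f)

namespace Cfg

variable {V ι : Type} (C : Cfg V ι)

def dual : Cfg V ι where
  P := C.P
  E := C.E
  X := fun v => - C.X v
  lo := C.hi
  hi := C.lo
  S := fun a b f => C.S b a f
  ab := C.ab
  Free := fun a b => C.Free b a
  inj := fun u hu v hv h => C.inj u hu v hv (by linarith)
  loP := C.hiP
  hiP := C.loP
  lolo := C.hihi
  hihi := C.lolo
  freeL := fun a b h => ⟨(C.freeR b a h).1, fun e he => ((C.freeR b a h).2 e he).symm⟩
  freeR := fun a b h => ⟨(C.freeL b a h).1, fun e he => ((C.freeL b a h).2 e he).symm⟩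
  freeLt := fun a b h => by have := C.freeLt b a h; linarith
  A1l := fun a b h f hf h1 h2 => C.A1r b a h f hf (by linarith) (by linarith)
  A1r := fun a b h f hf h1 h2 => C.A1l b a h f hf (by linarith) (by linarith)
  A2 := fun a b h e he f hf r hr h1 h2 h3 h4 h5 =>
    C.A2 b a h e he f hf r hr.symm (by linarith) (by linarith) (by linarith) (by linarith) h5

def Iso (v : V) : Prop := ∀ e ∈ C.E, C.lo e ≠ v ∧ C.hi e ≠ v
def Rt (v : V) : Prop := ∃ e ∈ C.E, C.hi e = v
def Sp (f : ι) (r : V) : Prop := C.X (C.lo f) < C.X r ∧ C.X r < C.X (C.hi f)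
def Vis (a b r : V) : Prop :=
  C.X a < C.X r ∧ C.X r < C.X b ∧ ∀ f ∈ C.E, C.Sp f r → (C.S a b f ↔ C.ab r f)
noncomputable def cost (a b : V) : ℕ := (C.P.filter fun r => (C.Iso r ∨ C.Rt r) ∧ C.Vis a b r).card
def Clear (a b : V) : Prop := ∀ r ∈ C.P, C.Iso r → ¬ C.Vis a b r
def LI (q : V) : Prop := ∃ a b, C.Free a b ∧ C.Vis a b q ∧
  ∀ r ∈ C.P, (C.Iso r ∨ C.Rt r) → C.X r < C.X q → ¬ C.Vis a b r
def Act (t : ℝ) (f : ι) : Prop := C.X (C.lo f) < t ∧ t ≤ C.X (C.hi f)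
def Same (t : ℝ) (s s' : V × V) : Prop :=
  ∀ f ∈ C.E, C.Act t f → (C.S s.1 s.2 f ↔ C.S s'.1 s'.2 f)

structure St (t : ℝ) (Q : Finset (V × V)) : Prop where
  free : ∀ s ∈ Q, C.Free s.1 s.2
  lt : ∀ s ∈ Q, C.X s.1 < t
  le : ∀ s ∈ Q, t ≤ C.X s.2
  same : ∀ s ∈ Q, ∀ s' ∈ Q, C.Same t s s'

noncomputable def pc (t : ℝ) (s : V × V) : ℕ :=
  (C.P.filter fun r => t ≤ C.X r ∧ (C.Iso r ∨ C.Rt r) ∧ C.Vis s.1 s.2 r).card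

theorem St.sub {C : Cfg V ι} {t : ℝ} {Q Q' : Finset (V × V)} (h : C.St t Q) (hs : Q' ⊆ Q) :
    C.St t Q' :=
  ⟨fun s hq => h.free s (hs hq), fun s hq => h.lt s (hs hq), fun s hq => h.le s (hs hq),
    fun s hq s' hq' => h.same s (hs hq) s' (hs hq')⟩

theorem pc_le_cost (t : ℝ) (s : V × V) : C.pc t s ≤ C.cost s.1 s.2 := by
  unfold pc cost
  apply Finset.card_le_card
  intro r
  simp only [Finset.mem_filter]
  tauto

theorem pc_step {t : ℝ} {s : V × V} {r : V} (hr : r ∈ C.P) (hrt : C.X r < t)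
    (h : C.Iso r ∨ C.Rt r) (hv : C.Vis s.1 s.2 r) : C.pc t s + 1 ≤ C.pc (C.X r) s := by
  unfold pc
  apply Nat.succ_le_of_lt
  apply Finset.card_lt_card
  rw [Finset.ssubset_iff_of_subset]
  · refine ⟨r, ?_, ?_⟩
    · simp [hr, h, hv]
    · simp [hr, hrt]
  · intro u
    simp only [Finset.mem_filter]
    rintro ⟨h1, h2, h3⟩
    exact ⟨h1, by linarith, h3⟩

/-- next event -/
def Nxt (t : ℝ) (r : V) : Prop := r ∈ C.P ∧ C.X r < t ∧ ∀ u ∈ C.P, C.X u < t → C.X u ≤ C.X r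

theorem sp_act {t : ℝ} {r : V} (h : C.Nxt t r) {f : ι} (hf : f ∈ C.E) (hs : C.Sp f r) :
    C.Act t f := by
  refine ⟨by linarith [hs.1, h.2.1], ?_⟩
  by_contra hc
  have := h.2.2 _ (C.hiP f hf) (by linarith)
  linarith [hs.2]

theorem vis_iff {t : ℝ} {r : V} (h : C.Nxt t r) {s s' : V × V} (hs : C.Same t s s')
    (h1' : C.X s'.1 < C.X r) (h2' : t ≤ C.X s'.2)
    (hv : C.Vis s.1 s.2 r) : C.Vis s'.1 s'.2 r := by
  refine ⟨h1', by linarith [h.2.1], fun f hf hsp => ?_⟩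
  rw [← hs f hf (C.sp_act h hf hsp)]
  exact hv.2.2 f hf hsp

theorem vis_target {t : ℝ} {r : V} (h : C.Nxt t r) {s s' : V × V} (hs : C.Same t s s')
    (h1' : C.X s'.1 < C.X r) (h2' : t ≤ C.X s'.2) (hf : C.Free s.1 s.2)
    (hr : s.1 = r) : C.Vis s'.1 s'.2 r := by
  refine ⟨h1', by linarith [h.2.1], fun f hfE hsp => ?_⟩
  rw [← hs f hfE (C.sp_act h hfE hsp)]
  subst hr
  exact C.A1l _ _ hf f hfE hsp.1 hsp.2

theorem act_cases {t : ℝ} {r : V} (h : C.Nxt t r) {f : ι} (hf : f ∈ C.E)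
    (ha : C.Act (C.X r) f) : C.Act t f ∨ C.hi f = r := by
  by_cases hc : t ≤ C.X (C.hi f)
  · exact Or.inl ⟨by linarith [ha.1, h.2.1], hc⟩
  · right
    push Not at hc
    have := h.2.2 _ (C.hiP f hf) hc
    exact C.inj _ (C.hiP f hf) _ h.1 (le_antisymm this ha.2)

theorem same_step {t : ℝ} {r : V} (h : C.Nxt t r) {s s' : V × V} (hs : C.Same t s s')
    (hF : C.Free s.1 s.2) (hF' : C.Free s'.1 s'.2)
    (h1 : C.X s.1 < C.X r) (h2 : t ≤ C.X s.2)
    (h1' : C.X s'.1 < C.X r) (h2' : t ≤ C.X s'.2)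
    (hn : C.Rt r → ¬ C.Vis s.1 s.2 r) : C.Same (C.X r) s s' := by
  intro f hf ha
  rcases C.act_cases h hf ha with ha | hr
  · exact hs f hf ha
  · have hv := hn ⟨f, hf, hr⟩
    have : ∃ g ∈ C.E, C.Sp g r ∧ ¬ (C.S s.1 s.2 g ↔ C.ab r g) := by
      by_contra hc
      push Not at hc
      exact hv ⟨h1, by linarith [h.2.1], fun g hg hsp => by have := hc g hg hsp; tauto⟩
    obtain ⟨g, hg, hsp, hne⟩ := this
    have hsg := hs g hg (C.sp_act h hg hsp)
    have e1 := C.A2 _ _ hF f hf g hg r (Or.inr hr) h1 (by linarith [h.2.1]) hsp.1 hsp.2 (by tauto)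
    have e2 := C.A2 _ _ hF' f hf g hg r (Or.inr hr) h1' (by linarith [h.2.1]) hsp.1 hsp.2
      (by tauto)
    rw [e1, e2, hsg]

theorem same_split {t : ℝ} {r : V} (h : C.Nxt t r) {s s' : V × V} (hs : C.Same t s s')
    {e : ι} (he : e ∈ C.E) (hr : C.hi e = r) (hee : C.S s.1 s.2 e ↔ C.S s'.1 s'.2 e) :
    C.Same (C.X r) s s' := by
  intro f hf ha
  rcases C.act_cases h hf ha with ha | hr'
  · exact hs f hf ha
  · have : f = e := C.hihi f hf e he (hr'.trans hr.symm)
    rw [this]; exact hee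

theorem adv (n : ℕ) : ∀ (t : ℝ) (Q : Finset (V × V)), (C.P.filter fun r => C.X r < t).card = n →
    C.St t Q → Q.Nonempty → ∃ r ∈ C.P, C.X r < t ∧
      (∀ s ∈ Q, ∀ u ∈ C.P, (C.Iso u ∨ C.Rt u) → C.X r < C.X u → C.X u < t →
        ¬ C.Vis s.1 s.2 u) ∧
      ((C.Rt r ∧ (∀ s ∈ Q, C.Vis s.1 s.2 r) ∧ ∃ Q1 Q2, Q = Q1 ∪ Q2 ∧
          C.St (C.X r) Q1 ∧ C.St (C.X r) Q2) ∨
       (C.Iso r ∧ (∀ s ∈ Q, s.1 ≠ r → C.Vis s.1 s.2 r) ∧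
          C.St (C.X r) (Q.filter fun s => s.1 ≠ r))) := by
  induction n using Nat.strong_induction_on with
  | _ n ih =>
  intro t Q hn hSt hne
  obtain ⟨s0, hs0⟩ := hne
  have hne' : (C.P.filter fun r => C.X r < t).Nonempty :=
    ⟨s0.1, by simp [(C.freeL _ _ (hSt.free s0 hs0)).1, hSt.lt s0 hs0]⟩
  obtain ⟨r, hr, hmax⟩ := Finset.exists_max_image _ C.X hne'
  simp only [Finset.mem_filter] at hr hmax
  have hN : C.Nxt t r := ⟨hr.1, hr.2, fun u hu hut => hmax u ⟨hu, hut⟩⟩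
  have hleft : ∀ s ∈ Q, s.1 ≠ r → C.X s.1 < C.X r := by
    intro s hs hsr
    have hm := (C.freeL _ _ (hSt.free s hs)).1
    refine lt_of_le_of_ne (hN.2.2 _ hm (hSt.lt s hs)) fun h => hsr (C.inj _ hm _ hr.1 h)
  have hbetween : ∀ s ∈ Q, ∀ u ∈ C.P, (C.Iso u ∨ C.Rt u) → C.X r < C.X u → C.X u < t →
        ¬ C.Vis s.1 s.2 u := by
    intro s _ u hu _ h1 h2
    linarith [hN.2.2 u hu h2]
  -- continuation
  have cont : (∀ s ∈ Q, s.1 ≠ r) → ((C.Iso r ∨ C.Rt r) → ∀ s ∈ Q, ¬ C.Vis s.1 s.2 r) →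
      ∃ r ∈ C.P, C.X r < t ∧
      (∀ s ∈ Q, ∀ u ∈ C.P, (C.Iso u ∨ C.Rt u) → C.X r < C.X u → C.X u < t →
        ¬ C.Vis s.1 s.2 u) ∧
      ((C.Rt r ∧ (∀ s ∈ Q, C.Vis s.1 s.2 r) ∧ ∃ Q1 Q2, Q = Q1 ∪ Q2 ∧
          C.St (C.X r) Q1 ∧ C.St (C.X r) Q2) ∨
       (C.Iso r ∧ (∀ s ∈ Q, s.1 ≠ r → C.Vis s.1 s.2 r) ∧
          C.St (C.X r) (Q.filter fun s => s.1 ≠ r))) := by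
    intro hnr hnv
    have hSt' : C.St (C.X r) Q := by
      refine ⟨hSt.free, fun s hs => hleft s hs (hnr s hs), fun s hs => ?_, fun s hs s' hs' => ?_⟩
      · linarith [hSt.le s hs, hr.2]
      · exact C.same_step hN (hSt.same s hs s' hs') (hSt.free s hs) (hSt.free s' hs')
          (hleft s hs (hnr s hs)) (hSt.le s hs) (hleft s' hs' (hnr s' hs')) (hSt.le s' hs')
          (fun h => hnv (Or.inr h) s hs)
    have hlt : (C.P.filter fun u => C.X u < C.X r).card < n := by
      rw [← hn]
      apply Finset.card_lt_card
      rw [Finset.ssubset_iff_of_subset]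
      · exact ⟨r, by simp [hr], by simp⟩
      · intro u
        simp only [Finset.mem_filter]
        rintro ⟨h1, h2⟩
        exact ⟨h1, by linarith [hr.2]⟩
    obtain ⟨r', hr', hlt', hb, hfin⟩ := ih _ hlt (C.X r) Q rfl hSt' ⟨s0, hs0⟩
    refine ⟨r', hr', by linarith [hr.2], ?_, hfin⟩
    intro s hs u hu hIR h1 h2
    rcases lt_or_ge (C.X u) (C.X r) with h | h
    · exact hb s hs u hu hIR h1 h
    · have : u = r := C.inj u hu r hr.1 (le_antisymm (hN.2.2 u hu h2) h)
      subst this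
      exact hnv hIR s hs
  by_cases hI : C.Iso r
  · by_cases hex : ∃ s ∈ Q, s.1 = r ∨ C.Vis s.1 s.2 r
    · refine ⟨r, hr.1, hr.2, hbetween, Or.inr ⟨hI, ?_, ?_⟩⟩
      · intro s hs hsr
        obtain ⟨s1, hs1, h | h⟩ := hex
        · exact C.vis_target hN (hSt.same s1 hs1 s hs) (hleft s hs hsr) (hSt.le s hs)
            (hSt.free s1 hs1) h
        · exact C.vis_iff hN (hSt.same s1 hs1 s hs) (hleft s hs hsr) (hSt.le s hs) h
      · have hnR : ¬ C.Rt r := by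
          rintro ⟨e, he, h⟩; exact (hI e he).2 h
        have hmem : ∀ s, s ∈ Q.filter (fun s => s.1 ≠ r) ↔ s ∈ Q ∧ s.1 ≠ r := by
          intro s; simp
        refine ⟨fun s hs => ?_, fun s hs => ?_, fun s hs => ?_, fun s hs s' hs' => ?_⟩
        · exact hSt.free s ((hmem s).1 hs).1
        · exact hleft s ((hmem s).1 hs).1 ((hmem s).1 hs).2
        · linarith [hSt.le s ((hmem s).1 hs).1, hr.2]
        · obtain ⟨hs, hsr⟩ := (hmem s).1 hs
          obtain ⟨hs', hsr'⟩ := (hmem s').1 hs'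
          exact C.same_step hN (hSt.same s hs s' hs') (hSt.free s hs) (hSt.free s' hs')
            (hleft s hs hsr) (hSt.le s hs) (hleft s' hs' hsr') (hSt.le s' hs')
            (fun h => absurd h hnR)
    · push Not at hex
      exact cont (fun s hs => (hex s hs).1) (fun _ s hs => (hex s hs).2)
  · have hnr : ∀ s ∈ Q, s.1 ≠ r := by
      rintro s hs rfl
      exact hI (C.freeL _ _ (hSt.free s hs)).2
    by_cases hR : C.Rt r
    · by_cases hex : ∃ s ∈ Q, C.Vis s.1 s.2 r
      · obtain ⟨s1, hs1, h⟩ := hex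
        obtain ⟨e, he, her⟩ := id hR
        refine ⟨r, hr.1, hr.2, hbetween, Or.inl ⟨hR, ?_, ?_⟩⟩
        · intro s hs
          exact C.vis_iff hN (hSt.same s1 hs1 s hs) (hleft s hs (hnr s hs)) (hSt.le s hs) h
        · refine ⟨Q.filter fun s => C.S s.1 s.2 e, Q.filter fun s => ¬ C.S s.1 s.2 e, ?_, ?_, ?_⟩
          · ext s; simp only [Finset.mem_union, Finset.mem_filter]; tauto
          · refine ⟨fun s hs => ?_, fun s hs => ?_, fun s hs => ?_, fun s hs s' hs' => ?_⟩
            · exact hSt.free s (Finset.mem_filter.1 hs).1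
            · exact hleft s (Finset.mem_filter.1 hs).1 (hnr _ (Finset.mem_filter.1 hs).1)
            · linarith [hSt.le s (Finset.mem_filter.1 hs).1, hr.2]
            · have a := Finset.mem_filter.1 hs
              have b := Finset.mem_filter.1 hs'
              exact C.same_split hN (hSt.same s a.1 s' b.1) he her (by tauto)
          · refine ⟨fun s hs => ?_, fun s hs => ?_, fun s hs => ?_, fun s hs s' hs' => ?_⟩
            · exact hSt.free s (Finset.mem_filter.1 hs).1
            · exact hleft s (Finset.mem_filter.1 hs).1 (hnr _ (Finset.mem_filter.1 hs).1)
            · linarith [hSt.le s (Finset.mem_filter.1 hs).1, hr.2]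
            · have a := Finset.mem_filter.1 hs
              have b := Finset.mem_filter.1 hs'
              exact C.same_split hN (hSt.same s a.1 s' b.1) he her (by tauto)
      · push Not at hex
        exact cont hnr (fun _ s hs => hex s hs)
    · exact cont hnr (fun h => absurd h (by tauto))



def Wv (c : ℕ) : ℕ :=
  match c with
  | 0 => 384 | 1 => 192 | 2 => 96 | 3 => 48 | 4 => 16 | _ + 5 => 0

def Fv (c : ℕ) : ℕ :=
  match c with
  | 0 => 440 | 1 => 220 | 2 => 110 | 3 => 55 | 4 => 23 | 5 => 7 | _ + 6 => 0

def Hv (c : ℕ) : ℕ :=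
  match c with
  | 0 => 356 | 1 => 178 | 2 => 89 | 3 => 41 | 4 => 16 | _ + 5 => 0

theorem Wv_two (c : ℕ) : 2 * Wv (c + 1) ≤ Wv c := by
  match c with
  | 0 | 1 | 2 | 3 | 4 => simp [Wv]
  | _ + 5 => simp [Wv]

theorem Wv_one (c : ℕ) : (80 - 16 * c) + Wv (c + 1) ≤ Wv c := by
  match c with
  | 0 | 1 | 2 | 3 | 4 => simp [Wv]
  | k + 5 => simp [Wv]; omega

theorem Fv_two (c : ℕ) : 2 * Fv (c + 1) ≤ Fv c := by
  match c with
  | 0 | 1 | 2 | 3 | 4 | 5 => simp [Fv]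
  | _ + 6 => simp [Fv]

theorem Fv_one (c : ℕ) : (87 - 16 * c) + Wv (c + 1) ≤ Fv c := by
  match c with
  | 0 | 1 | 2 | 3 | 4 | 5 => simp [Fv, Wv]
  | k + 6 => simp [Fv, Wv]; omega

theorem Hv_two (c : ℕ) : 2 * Hv (c + 1) ≤ Hv c := by
  match c with
  | 0 | 1 | 2 | 3 | 4 => simp [Hv]
  | _ + 5 => simp [Hv]

theorem Hv_one (c : ℕ) : (73 - 16 * c) + Wv (c + 1) ≤ Hv c := by
  match c with
  | 0 | 1 | 2 | 3 | 4 => simp [Hv, Wv]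
  | k + 5 => simp [Hv, Wv]; omega

theorem Hv_one' (c : ℕ) : (80 - 16 * c) + 2 * Wv (c + 2) ≤ Hv c := by
  match c with
  | 0 | 1 | 2 | 3 | 4 => simp [Hv, Wv]
  | k + 5 => simp [Hv, Wv]; omega

theorem sum_union_le' (Q1 Q2 : Finset (V × V)) (g : V × V → ℕ) :
    ∑ s ∈ Q1 ∪ Q2, g s ≤ ∑ s ∈ Q1, g s + ∑ s ∈ Q2, g s := by
  rw [← Finset.sum_union_inter]; omega

/-- splitting off the segments starting at `r` -/
theorem sum_split_r (Q : Finset (V × V)) (p r : V) (hp : ∀ s ∈ Q, s.2 = p) (g : V × V → ℕ)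
    (A : ℕ) (hA : (r, p) ∈ Q → g (r, p) ≤ A) :
    ∑ s ∈ Q, g s ≤ A + ∑ s ∈ Q.filter (fun s => s.1 ≠ r), g s := by
  rw [← Finset.sum_filter_add_sum_filter_not Q (fun s => s.1 ≠ r)]
  have : ∑ s ∈ Q.filter (fun s => ¬ s.1 ≠ r), g s ≤ A := by
    have hsub : Q.filter (fun s => ¬ s.1 ≠ r) ⊆ {(r, p)} := by
      intro s hs
      simp only [ne_eq, not_not, Finset.mem_filter] at hs
      simp only [Finset.mem_singleton]
      exact Prod.ext hs.2 (hp s hs.1)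
    rcases Finset.subset_singleton_iff.1 hsub with h | h
    · rw [h]; simp
    · rw [h]; simp only [Finset.sum_singleton]
      apply hA
      have : (r, p) ∈ Q.filter (fun s => ¬ s.1 ≠ r) := by rw [h]; simp
      exact (Finset.mem_filter.1 this).1
  omega

theorem Wsum (p : V) (k : ℕ) : ∀ (c : ℕ) (t : ℝ) (Q : Finset (V × V)), 5 ≤ c + k → C.St t Q →
    (∀ s ∈ Q, s.2 = p) → (∀ s ∈ Q, c ≤ C.pc t s) →
    ∑ s ∈ Q, (80 - 16 * C.cost s.1 s.2) ≤ Wv c := by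
  induction k with
  | zero =>
    intro c t Q hc hSt hp hpc
    have : ∑ s ∈ Q, (80 - 16 * C.cost s.1 s.2) = 0 := by
      apply Finset.sum_eq_zero
      intro s hs
      have := hpc s hs
      have := C.pc_le_cost t s
      omega
    omega
  | succ k ih =>
    intro c t Q hc hSt hp hpc
    rcases Q.eq_empty_or_nonempty with rfl | hne
    · simp
    obtain ⟨r, hr, hrt, hb, h | h⟩ := C.adv _ t Q rfl hSt hne
    · obtain ⟨hR, hv, Q1, Q2, rfl, h1, h2⟩ := h
      have b1 := ih (c + 1) _ Q1 (by omega) h1 (fun s hs => hp s (Finset.mem_union_left _ hs))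
        (fun s hs => by
          have hs' := Finset.mem_union_left Q2 hs
          have := hpc s hs'
          have := C.pc_step hr hrt (Or.inr hR) (hv s hs')
          omega)
      have b2 := ih (c + 1) _ Q2 (by omega) h2 (fun s hs => hp s (Finset.mem_union_right _ hs))
        (fun s hs => by
          have hs' := Finset.mem_union_right Q1 hs
          have := hpc s hs'
          have := C.pc_step hr hrt (Or.inr hR) (hv s hs')
          omega)
      have := sum_union_le' Q1 Q2 (fun s => (80 - 16 * C.cost s.1 s.2))
      have := Wv_two c
      omega
    · obtain ⟨hI, hv, h1⟩ := h
      have b1 := ih (c + 1) _ _ (by omega) h1 (fun s hs => hp s (Finset.mem_filter.1 hs).1)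
        (fun s hs => by
          have hs' := Finset.mem_filter.1 hs
          have := hpc s hs'.1
          have := C.pc_step hr hrt (Or.inl hI) (hv s hs'.1 hs'.2)
          omega)
      have := sum_split_r Q p r hp (fun s => (80 - 16 * C.cost s.1 s.2)) (80 - 16 * c)
        (fun hs => by
          have := hpc _ hs
          have := C.pc_le_cost t (r, p)
          simp only at *
          omega)
      have := Wv_one c
      omega

/-- the weight -/
noncomputable def g (ρ : Prop) (s : V × V) : ℕ :=
  if C.Clear s.1 s.2 then
    (if ρ then (if C.LI s.1 then 80 else 87) else (if C.LI s.1 then 73 else 80))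
      - 16 * C.cost s.1 s.2
  else 80 - 16 * C.cost s.1 s.2

theorem g_nonclear (ρ : Prop) (s : V × V) (r : V) (hr : r ∈ C.P) (hI : C.Iso r)
    (hv : C.Vis s.1 s.2 r) : C.g ρ s = 80 - 16 * C.cost s.1 s.2 := by
  unfold g
  rw [if_neg]
  intro h
  exact h r hr hI hv

theorem g_le (ρ : Prop) (s : V × V) : C.g ρ s ≤ 87 - 16 * C.cost s.1 s.2 := by
  unfold g
  split_ifs <;> omega

theorem g_le' (s : V × V) : C.g False s ≤ 80 - 16 * C.cost s.1 s.2 := by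
  unfold g
  simp only [if_false]
  split_ifs <;> omega

theorem Fsum (p : V) (ρ : Prop) (k : ℕ) : ∀ (c : ℕ) (t : ℝ) (Q : Finset (V × V)), 6 ≤ c + k →
    C.St t Q → (∀ s ∈ Q, s.2 = p) → (∀ s ∈ Q, c ≤ C.pc t s) →
    ∑ s ∈ Q, C.g ρ s ≤ Fv c := by
  induction k with
  | zero =>
    intro c t Q hc hSt hp hpc
    have : ∑ s ∈ Q, C.g ρ s = 0 := by
      apply Finset.sum_eq_zero
      intro s hs
      have := hpc s hs
      have := C.pc_le_cost t s
      have := C.g_le ρ s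
      omega
    omega
  | succ k ih =>
    intro c t Q hc hSt hp hpc
    rcases Q.eq_empty_or_nonempty with rfl | hne
    · simp
    obtain ⟨r, hr, hrt, hb, h | h⟩ := C.adv _ t Q rfl hSt hne
    · obtain ⟨hR, hv, Q1, Q2, rfl, h1, h2⟩ := h
      have b1 := ih (c + 1) _ Q1 (by omega) h1 (fun s hs => hp s (Finset.mem_union_left _ hs))
        (fun s hs => by
          have hs' := Finset.mem_union_left Q2 hs
          have := hpc s hs'
          have := C.pc_step hr hrt (Or.inr hR) (hv s hs')
          omega)
      have b2 := ih (c + 1) _ Q2 (by omega) h2 (fun s hs => hp s (Finset.mem_union_right _ hs))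
        (fun s hs => by
          have hs' := Finset.mem_union_right Q1 hs
          have := hpc s hs'
          have := C.pc_step hr hrt (Or.inr hR) (hv s hs')
          omega)
      have := sum_union_le' Q1 Q2 (fun s => C.g ρ s)
      have := Fv_two c
      omega
    · obtain ⟨hI, hv, h1⟩ := h
      have b1 := C.Wsum p 5 (c + 1) _ _ (by omega) h1 (fun s hs => hp s (Finset.mem_filter.1 hs).1)
        (fun s hs => by
          have hs' := Finset.mem_filter.1 hs
          have := hpc s hs'.1
          have := C.pc_step hr hrt (Or.inl hI) (hv s hs'.1 hs'.2)
          omega)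
      have b2 : ∑ s ∈ Q.filter (fun s => s.1 ≠ r), C.g ρ s =
          ∑ s ∈ Q.filter (fun s => s.1 ≠ r), (80 - 16 * C.cost s.1 s.2) := by
        apply Finset.sum_congr rfl
        intro s hs
        have hs' := Finset.mem_filter.1 hs
        exact C.g_nonclear ρ s r hr hI (hv s hs'.1 hs'.2)
      have := sum_split_r Q p r hp (fun s => C.g ρ s) (87 - 16 * c)
        (fun hs => by
          have := hpc _ hs
          have := C.pc_le_cost t (r, p)
          have := C.g_le ρ (r, p)
          simp only at *
          omega)
      have := Fv_one c
      omega

/-- after an isolated point `r` without `LI` -/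
theorem Hsum_aux (p : V) (c : ℕ) (r : V) (Q : Finset (V × V))
    (hSt : C.St (C.X r) Q) (hp : ∀ s ∈ Q, s.2 = p) (hpc : ∀ s ∈ Q, c ≤ C.pc (C.X r) s)
    (hv : ∀ s ∈ Q, C.Vis s.1 s.2 r) (hLI : ¬ C.LI r) :
    ∑ s ∈ Q, (80 - 16 * C.cost s.1 s.2) ≤ 2 * Wv (c + 1) := by
  rcases Q.eq_empty_or_nonempty with rfl | hne
  · simp
  obtain ⟨r', hr', hrt', hb, h | h⟩ := C.adv _ _ Q rfl hSt hne
  · obtain ⟨hR, hv', Q1, Q2, rfl, h1, h2⟩ := h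
    have b1 := C.Wsum p 5 (c + 1) _ Q1 (by omega) h1
      (fun s hs => hp s (Finset.mem_union_left _ hs))
      (fun s hs => by
        have hs' := Finset.mem_union_left Q2 hs
        have := hpc s hs'
        have := C.pc_step hr' hrt' (Or.inr hR) (hv' s hs')
        omega)
    have b2 := C.Wsum p 5 (c + 1) _ Q2 (by omega) h2
      (fun s hs => hp s (Finset.mem_union_right _ hs))
      (fun s hs => by
        have hs' := Finset.mem_union_right Q1 hs
        have := hpc s hs'
        have := C.pc_step hr' hrt' (Or.inr hR) (hv' s hs')
        omega)
    have := sum_union_le' Q1 Q2 (fun s => (80 - 16 * C.cost s.1 s.2))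
    omega
  · obtain ⟨hI, hv', h1⟩ := h
    have b1 := C.Wsum p 5 (c + 1) _ _ (by omega) h1 (fun s hs => hp s (Finset.mem_filter.1 hs).1)
        (fun s hs => by
          have hs' := Finset.mem_filter.1 hs
          have := hpc s hs'.1
          have := C.pc_step hr' hrt' (Or.inl hI) (hv' s hs'.1 hs'.2)
          omega)
    have := sum_split_r Q p r' hp (fun s => (80 - 16 * C.cost s.1 s.2)) 0
        (fun hs => by
          exfalso
          apply hLI
          refine ⟨r', p, hSt.free _ hs, hv _ hs, ?_⟩
          intro u hu hIR hur hvu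
          exact hb _ hs u hu hIR hvu.1 hur hvu)
    omega

theorem Hsum (p : V) (k : ℕ) : ∀ (c : ℕ) (t : ℝ) (Q : Finset (V × V)), 5 ≤ c + k →
    C.St t Q → (∀ s ∈ Q, s.2 = p) → (∀ s ∈ Q, c ≤ C.pc t s) →
    (∀ s ∈ Q, ∀ u ∈ C.P, C.Iso u → t ≤ C.X u → ¬ C.Vis s.1 s.2 u) →
    ∑ s ∈ Q, C.g False s ≤ Hv c := by
  induction k with
  | zero =>
    intro c t Q hc hSt hp hpc _
    have : ∑ s ∈ Q, C.g False s = 0 := by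
      apply Finset.sum_eq_zero
      intro s hs
      have := hpc s hs
      have := C.pc_le_cost t s
      have := C.g_le' s
      omega
    omega
  | succ k ih =>
    intro c t Q hc hSt hp hpc hcl
    rcases Q.eq_empty_or_nonempty with rfl | hne
    · simp
    obtain ⟨r, hr, hrt, hb, h | h⟩ := C.adv _ t Q rfl hSt hne
    · obtain ⟨hR, hv, Q1, Q2, rfl, h1, h2⟩ := h
      have hcl' : ∀ s ∈ Q1 ∪ Q2, ∀ u ∈ C.P, C.Iso u → C.X r ≤ C.X u → ¬ C.Vis s.1 s.2 u := by
        intro s hs u hu hI hru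
        rcases lt_or_ge (C.X u) t with h | h
        · rcases eq_or_lt_of_le hru with h' | h'
          · have := C.inj _ hr _ hu h'
            subst this
            obtain ⟨e, he, her⟩ := hR
            exact absurd her (hI e he).2
          · exact hb s hs u hu (Or.inl hI) h' h
        · exact hcl s hs u hu hI h
      have b1 := ih (c + 1) _ Q1 (by omega) h1 (fun s hs => hp s (Finset.mem_union_left _ hs))
        (fun s hs => by
          have hs' := Finset.mem_union_left Q2 hs
          have := hpc s hs'
          have := C.pc_step hr hrt (Or.inr hR) (hv s hs')
          omega) (fun s hs => hcl' s (Finset.mem_union_left _ hs))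
      have b2 := ih (c + 1) _ Q2 (by omega) h2 (fun s hs => hp s (Finset.mem_union_right _ hs))
        (fun s hs => by
          have hs' := Finset.mem_union_right Q1 hs
          have := hpc s hs'
          have := C.pc_step hr hrt (Or.inr hR) (hv s hs')
          omega) (fun s hs => hcl' s (Finset.mem_union_right _ hs))
      have := sum_union_le' Q1 Q2 (fun s => C.g False s)
      have := Hv_two c
      omega
    · obtain ⟨hI, hv, h1⟩ := h
      have hpc' : ∀ s ∈ Q.filter (fun s => s.1 ≠ r), c + 1 ≤ C.pc (C.X r) s :=
        (fun s hs => by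
          have hs' := Finset.mem_filter.1 hs
          have := hpc s hs'.1
          have := C.pc_step hr hrt (Or.inl hI) (hv s hs'.1 hs'.2)
          omega)
      have hp' : ∀ s ∈ Q.filter (fun s => s.1 ≠ r), s.2 = p :=
        fun s hs => hp s (Finset.mem_filter.1 hs).1
      have b2 : ∑ s ∈ Q.filter (fun s => s.1 ≠ r), C.g False s =
          ∑ s ∈ Q.filter (fun s => s.1 ≠ r), (80 - 16 * C.cost s.1 s.2) := by
        apply Finset.sum_congr rfl
        intro s hs
        have hs' := Finset.mem_filter.1 hs
        exact C.g_nonclear False s r hr hI (hv s hs'.1 hs'.2)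
      by_cases hLI : C.LI r
      · have b1 := C.Wsum p 5 (c + 1) _ _ (by omega) h1 hp' hpc'
        have := sum_split_r Q p r hp (fun s => C.g False s) (73 - 16 * c)
          (fun hs => by
            have h1 := hpc _ hs
            have h2 := C.pc_le_cost t (r, p)
            have hclr : C.Clear r p := by
              intro u hu hIu hvu
              rcases lt_or_ge (C.X u) t with h | h
              · exact hb _ hs u hu (Or.inl hIu) hvu.1 h hvu
              · exact hcl _ hs u hu hIu h hvu
            unfold g
            simp only [if_pos hclr, if_pos hLI, if_false]
            simp only at h1 h2
            omega)
        have := Hv_one c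
        omega
      · have b1 := C.Hsum_aux p (c + 1) r _ h1 hp' hpc'
          (fun s hs => hv s (Finset.mem_filter.1 hs).1 (Finset.mem_filter.1 hs).2) hLI
        have := sum_split_r Q p r hp (fun s => C.g False s) (80 - 16 * c)
          (fun hs => by
            have h1 := hpc _ hs
            have h2 := C.pc_le_cost t (r, p)
            have := C.g_le' (r, p)
            simp only at *
            omega)
        have := Hv_one' c
        have e : c + 1 + 1 = c + 2 := rfl
        rw [e] at b1
        omega

/-- all candidate segments into `p` from the left -/
noncomputable def cand (p : V) : Finset (V × V) :=
  (C.P ×ˢ {p}).filter fun s => C.Free s.1 s.2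

theorem mem_cand (p : V) (s : V × V) : s ∈ C.cand p ↔ C.Free s.1 s.2 ∧ s.2 = p := by
  unfold cand
  simp only [Finset.mem_filter, Finset.mem_product, Finset.mem_singleton]
  constructor
  · tauto
  · rintro ⟨h1, h2⟩
    exact ⟨⟨(C.freeL _ _ h1).1, h2⟩, h1⟩

theorem iso_act {p : V} (hI : C.Iso p) (hp : p ∈ C.P) {f : ι} (hf : f ∈ C.E)
    (h : C.Act (C.X p) f) : C.Sp f p := by
  refine ⟨h.1, lt_of_le_of_ne h.2 fun h' => ?_⟩
  exact (hI f hf).2 (C.inj _ hp _ (C.hiP f hf) h').symm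

theorem cand_st (p : V) (hI : C.Iso p) (hp : p ∈ C.P) : C.St (C.X p) (C.cand p) := by
  refine ⟨fun s hs => ((C.mem_cand p s).1 hs).1, fun s hs => ?_, fun s hs => ?_,
    fun s hs s' hs' f hf ha => ?_⟩
  · obtain ⟨h1, h2⟩ := (C.mem_cand p s).1 hs
    rw [← h2]; exact C.freeLt _ _ h1
  · obtain ⟨h1, h2⟩ := (C.mem_cand p s).1 hs
    rw [← h2]
  · obtain ⟨h1, h2⟩ := (C.mem_cand p s).1 hs
    obtain ⟨h1', h2'⟩ := (C.mem_cand p s').1 hs'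
    have hsp := C.iso_act hI hp hf ha
    rw [C.A1r _ _ h1 f hf (by rw [h2]; exact hsp.1) (by rw [h2]; exact hsp.2),
      C.A1r _ _ h1' f hf (by rw [h2']; exact hsp.1) (by rw [h2']; exact hsp.2), h2, h2']

theorem bound_F (p : V) (hI : C.Iso p) (hp : p ∈ C.P) (ρ : Prop) :
    ∑ s ∈ C.cand p, C.g ρ s ≤ 440 :=
  C.Fsum p ρ 6 0 _ _ (by omega) (C.cand_st p hI hp) (fun s hs => ((C.mem_cand p s).1 hs).2)
    (fun _ _ => Nat.zero_le _)

theorem bound_H (p : V) (hI : C.Iso p) (hp : p ∈ C.P) :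
    ∑ s ∈ C.cand p, C.g False s ≤ 356 :=
  C.Hsum p 5 0 _ _ (by omega) (C.cand_st p hI hp) (fun s hs => ((C.mem_cand p s).1 hs).2)
    (fun _ _ => Nat.zero_le _) (fun s hs u _ _ h1 h2 => by
      have := h2.2.1
      rw [((C.mem_cand p s).1 hs).2] at this
      linarith)

theorem bound_LI (p : V) (hI : C.Iso p) (hp : p ∈ C.P) (hLI : C.LI p) (ρ : Prop) (A : ℕ)
    (hA : ∀ s, C.g ρ s ≤ A) :
    ∑ s ∈ C.cand p, C.g ρ s ≤ A + 192 := by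
  obtain ⟨a, b, hF, hV, hno⟩ := hLI
  have hc := C.cand_st p hI hp
  have hab : ∀ s ∈ C.cand p, ∀ f ∈ C.E, C.Act (C.X p) f → (C.S s.1 s.2 f ↔ C.S a b f) := by
    intro s hs f hf ha
    obtain ⟨h1, h2⟩ := (C.mem_cand p s).1 hs
    have hsp := C.iso_act hI hp hf ha
    rw [C.A1r _ _ h1 f hf (by rw [h2]; exact hsp.1) (by rw [h2]; exact hsp.2), h2,
      hV.2.2 f hf hsp]
  have hSt : C.St (C.X p) (insert (a, b) (C.cand p)) := by
    refine ⟨fun s hs => ?_, fun s hs => ?_, fun s hs => ?_, fun s hs s' hs' f hf ha => ?_⟩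
    · rcases Finset.mem_insert.1 hs with rfl | hs
      · exact hF
      · exact hc.free s hs
    · rcases Finset.mem_insert.1 hs with rfl | hs
      · exact hV.1
      · exact hc.lt s hs
    · rcases Finset.mem_insert.1 hs with rfl | hs
      · exact hV.2.1.le
      · exact hc.le s hs
    · rcases Finset.mem_insert.1 hs with rfl | hs
      · rcases Finset.mem_insert.1 hs' with rfl | hs'
        · rfl
        · exact (hab s' hs' f hf ha).symm
      · rcases Finset.mem_insert.1 hs' with rfl | hs'
        · exact hab s hs f hf ha
        · exact hc.same s hs s' hs' f hf ha
  have hmem : (a, b) ∈ insert (a, b) (C.cand p) := Finset.mem_insert_self _ _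
  obtain ⟨r, hr, hrt, hb, h | h⟩ := C.adv _ _ _ rfl hSt ⟨_, hmem⟩
  · exact absurd (h.2.1 _ hmem) (hno r hr (Or.inr h.1) hrt)
  · obtain ⟨hIr, hv, h1⟩ := h
    have hsub : (C.cand p).filter (fun s => s.1 ≠ r) ⊆
        (insert (a, b) (C.cand p)).filter (fun s => s.1 ≠ r) :=
      Finset.filter_subset_filter _ (Finset.subset_insert _ _)
    have hv' : ∀ s ∈ C.cand p, s.1 ≠ r → C.Vis s.1 s.2 r :=
      fun s hs => hv s (Finset.mem_insert_of_mem hs)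
    have b1 := C.Wsum p 5 1 _ _ (by omega) (h1.sub hsub)
        (fun s hs => ((C.mem_cand p s).1 (Finset.mem_filter.1 hs).1).2)
        (fun s hs => by
          have hs' := Finset.mem_filter.1 hs
          have := C.pc_step hr hrt (Or.inl hIr) (hv' s hs'.1 hs'.2)
          omega)
    have b2 : ∑ s ∈ (C.cand p).filter (fun s => s.1 ≠ r), C.g ρ s =
        ∑ s ∈ (C.cand p).filter (fun s => s.1 ≠ r), (80 - 16 * C.cost s.1 s.2) := by
      apply Finset.sum_congr rfl
      intro s hs
      have hs' := Finset.mem_filter.1 hs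
      exact C.g_nonclear ρ s r hr hIr (hv' s hs'.1 hs'.2)
    have := sum_split_r (C.cand p) p r (fun s hs => ((C.mem_cand p s).1 hs).2)
      (fun s => C.g ρ s) A (fun hs => hA _)
    simp only [Wv] at b1
    omega

theorem dual_iso (p : V) : C.dual.Iso p ↔ C.Iso p := by
  unfold Iso dual
  constructor <;> intro h e he <;> exact (h e he).symm

theorem dual_vis (a b r : V) : C.dual.Vis b a r ↔ C.Vis a b r := by
  unfold Vis Sp dual
  simp only [neg_lt_neg_iff]
  constructor
  · rintro ⟨h1, h2, h3⟩
    exact ⟨h2, h1, fun f hf hsp => h3 f hf hsp.symm⟩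
  · rintro ⟨h1, h2, h3⟩
    exact ⟨h2, h1, fun f hf hsp => h3 f hf hsp.symm⟩

theorem dual_clear (a b : V) : C.dual.Clear b a ↔ C.Clear a b := by
  unfold Clear
  simp only [dual_vis, dual_iso]
  rfl

theorem g_congr {ρ ρ' : Prop} (h : ρ ↔ ρ') (s : V × V) : C.g ρ s = C.g ρ' s := by
  rw [propext h]

theorem total (p : V) (hI : C.Iso p) (hp : p ∈ C.P) :
    ∑ s ∈ C.cand p, C.g (C.dual.LI p) s + ∑ s ∈ C.dual.cand p, C.dual.g (C.LI p) s ≤ 712 := by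
  have hI' : C.dual.Iso p := (C.dual_iso p).2 hI
  have hp' : p ∈ C.dual.P := hp
  have g87 : ∀ (D : Cfg V ι) (ρ : Prop) s, D.g ρ s ≤ 87 := fun D ρ s =>
    (D.g_le ρ s).trans (by omega)
  have g80 : ∀ (D : Cfg V ι) s, D.g False s ≤ 80 := fun D s =>
    (D.g_le' s).trans (by omega)
  by_cases h1 : C.LI p
  · by_cases h2 : C.dual.LI p
    · have := C.bound_LI p hI hp h1 (C.dual.LI p) 87 (g87 C _)
      have := C.dual.bound_LI p hI' hp' h2 (C.LI p) 87 (g87 _ _)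
      omega
    · rw [eq_false h2]
      have := C.bound_LI p hI hp h1 False 80 (g80 C)
      have := C.dual.bound_F p hI' hp' (C.LI p)
      omega
  · rw [eq_false h1]
    by_cases h2 : C.dual.LI p
    · have := C.dual.bound_LI p hI' hp' h2 False 80 (g80 _)
      have := C.bound_F p hI hp (C.dual.LI p)
      omega
    · rw [eq_false h2]
      have := C.bound_H p hI hp
      have := C.dual.bound_H p hI' hp'
      omega

theorem g_pair (a b : V) :
    160 ≤ C.g (C.dual.LI b) (a, b) + C.dual.g (C.LI a) (b, a)
      + 16 * (C.cost a b + C.dual.cost b a) := by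
  unfold g
  simp only [C.dual_clear]
  split_ifs <;> omega

end Cfg


namespace Cfg

variable {V ι : Type} (C : Cfg V ι)

noncomputable def fs : Finset (V × V) := (C.P ×ˢ C.P).filter fun e => C.Free e.1 e.2

theorem mem_fs (e : V × V) : e ∈ C.fs ↔ C.Free e.1 e.2 := by
  unfold fs
  simp only [Finset.mem_filter, Finset.mem_product]
  exact ⟨fun h => h.2, fun h => ⟨⟨(C.freeL _ _ h).1, (C.freeR _ _ h).1⟩, h⟩⟩

noncomputable def iso : Finset V := C.P.filter fun p => C.Iso p

theorem sum_cand (F : V → V × V → ℕ) :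
    ∑ e ∈ C.fs, F e.2 e = ∑ p ∈ C.iso, ∑ s ∈ C.cand p, F p s := by
  have hm : ∀ e ∈ C.fs, e.2 ∈ C.iso := by
    intro e he
    have := C.freeR _ _ ((C.mem_fs e).1 he)
    exact Finset.mem_filter.2 this
  rw [← Finset.sum_fiberwise_of_maps_to hm]
  apply Finset.sum_congr rfl
  intro p _
  have : C.fs.filter (fun e => e.2 = p) = C.cand p := by
    ext e
    rw [Finset.mem_filter, mem_fs, mem_cand]
  rw [this]
  apply Finset.sum_congr rfl
  intro s hs
  rw [((C.mem_cand p s).1 hs).2]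

theorem dual_isoset : C.dual.iso = C.iso := by
  unfold iso
  ext p
  simp only [Finset.mem_filter, dual_iso]
  rfl

theorem sum_swap (F : V × V → ℕ) :
    ∑ e ∈ C.fs, F (e.2, e.1) = ∑ e ∈ C.dual.fs, F e := by
  refine Finset.sum_bij' (fun e _ => (e.2, e.1)) (fun e _ => (e.2, e.1)) ?_ ?_ ?_ ?_ ?_
  · intro e he
    rw [mem_fs] at he ⊢
    exact he
  · intro e he
    rw [mem_fs] at he ⊢
    exact he
  · intro e _; rfl
  · intro e _; rfl
  · intro e _; rfl

theorem total_sum :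
    ∑ e ∈ C.fs, (C.g (C.dual.LI e.2) e + C.dual.g (C.LI e.1) (e.2, e.1)) ≤ 712 * C.iso.card := by
  rw [Finset.sum_add_distrib, C.sum_cand (fun p s => C.g (C.dual.LI p) s)]
  have h1 := C.sum_swap (fun e => C.dual.g (C.LI e.2) e)
  simp only at h1
  rw [h1, C.dual.sum_cand (fun p s => C.dual.g (C.LI p) s), dual_isoset, ← Finset.sum_add_distrib]
  rw [mul_comm, ← smul_eq_mul]
  apply Finset.sum_le_card_nsmul
  intro p hp
  have := Finset.mem_filter.1 hp
  exact C.total p this.2 this.1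

end Cfg

theorem yOn_right (e : Pt × Pt) (h : e.1.1 < e.2.1) : yOn e e.2.1 = e.2.2 := by
  unfold yOn
  have : e.2.1 - e.1.1 ≠ 0 := by linarith
  field_simp
  ring

theorem yOn_mem (e : Pt × Pt) (h : e.1.1 < e.2.1) (x : ℝ) (h1 : e.1.1 ≤ x) (h2 : x ≤ e.2.1) :
    ((x, yOn e x) : Pt) ∈ Seg e.1 e.2 := by
  have hd : 0 < e.2.1 - e.1.1 := by linarith
  have hd' := hd.ne'
  refine ⟨(e.2.1 - x) / (e.2.1 - e.1.1), (x - e.1.1) / (e.2.1 - e.1.1), ?_, ?_, ?_, ?_⟩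
  · exact div_nonneg (by linarith) hd.le
  · exact div_nonneg (by linarith) hd.le
  · field_simp
    ring
  · ext
    · simp only [Prod.fst_add, Prod.smul_fst, smul_eq_mul]
      field_simp
      ring
    · simp only [Prod.snd_add, Prod.smul_snd, smul_eq_mul, yOn]
      field_simp
      ring

theorem yOn_ne {e f : Pt × Pt} (he : e.1.1 < e.2.1) (hf : f.1.1 < f.2.1)
    (hd : Seg e.1 e.2 ∩ Seg f.1 f.2 = ∅) {x : ℝ} (h1 : e.1.1 ≤ x) (h2 : x ≤ e.2.1)
    (h3 : f.1.1 ≤ x) (h4 : x ≤ f.2.1) : yOn e x ≠ yOn f x := by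
  intro h
  have a := yOn_mem e he x h1 h2
  have b := yOn_mem f hf x h3 h4
  rw [← h] at b
  have : ((x, yOn e x) : Pt) ∈ Seg e.1 e.2 ∩ Seg f.1 f.2 := ⟨a, b⟩
  rw [hd] at this
  exact this

theorem yOn_sep {e f : Pt × Pt} (he : e.1.1 < e.2.1) (hf : f.1.1 < f.2.1)
    (hd : Seg e.1 e.2 ∩ Seg f.1 f.2 = ∅) {x x' : ℝ} (h1 : e.1.1 ≤ x) (h2 : x ≤ e.2.1)
    (h3 : f.1.1 ≤ x) (h4 : x ≤ f.2.1) (h1' : e.1.1 ≤ x') (h2' : x' ≤ e.2.1)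
    (h3' : f.1.1 ≤ x') (h4' : x' ≤ f.2.1) (h : yOn f x < yOn e x) : yOn f x' < yOn e x' := by
  by_contra hc
  push Not at hc
  have hcont : ContinuousOn (fun t => yOn e t - yOn f t) (Set.uIcc x' x) :=
    ((yOn_cont e).sub (yOn_cont f)).continuousOn
  have := intermediate_value_uIcc hcont
  have h0 : (0 : ℝ) ∈ Set.uIcc (yOn e x' - yOn f x') (yOn e x - yOn f x) := by
    rw [Set.mem_uIcc]
    left
    constructor <;> linarith
  obtain ⟨t, ht, ht0⟩ := this h0
  simp only at ht0
  have hb : min x' x ≤ t ∧ t ≤ max x' x := ht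
  refine yOn_ne he hf hd (x := t) ?_ ?_ ?_ ?_ (by linarith)
  · exact (le_min h1' h1).trans hb.1
  · exact hb.2.trans (max_le h2' h2)
  · exact (le_min h3' h3).trans hb.1
  · exact hb.2.trans (max_le h4' h4)

def SS (a b : Pt) (f : Pt × Pt) : Prop :=
  ∃ x, a.1 ≤ x ∧ x ≤ b.1 ∧ f.1.1 ≤ x ∧ x ≤ f.2.1 ∧ yOn f x < yOn (a, b) x

theorem SS_iff {a b : Pt} {f : Pt × Pt} (he : a.1 < b.1) (hf : f.1.1 < f.2.1)
    (hd : Seg a b ∩ Seg f.1 f.2 = ∅) {x : ℝ} (h1 : a.1 ≤ x) (h2 : x ≤ b.1)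
    (h3 : f.1.1 ≤ x) (h4 : x ≤ f.2.1) : SS a b f ↔ yOn f x < yOn (a, b) x := by
  constructor
  · rintro ⟨y, g1, g2, g3, g4, g5⟩
    exact yOn_sep (e := (a, b)) he hf hd g1 g2 g3 g4 h1 h2 h3 h4 g5
  · intro h
    exact ⟨x, h1, h2, h3, h4, h⟩

def FreeE (P : Finset Pt) (M : Finset (Pt × Pt)) (e : Pt × Pt) : Prop :=
  e ∉ M ∧ IsMatching P (insert e M)

theorem FreeE.facts {P : Finset Pt} {M : Finset (Pt × Pt)} {e : Pt × Pt} (h : FreeE P M e) :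
    e.1 ∈ P ∧ e.2 ∈ P ∧ e.1.1 < e.2.1 ∧ ∀ f ∈ M, f.1 ≠ e.1 ∧ f.2 ≠ e.1 ∧ f.1 ≠ e.2 ∧ f.2 ≠ e.2 ∧
      Seg e.1 e.2 ∩ Seg f.1 f.2 = ∅ := by
  obtain ⟨h0, h⟩ := h
  have hm : e ∈ insert e M := Finset.mem_insert_self _ _
  refine ⟨h.left_mem e hm, h.right_mem e hm, h.x_lt e hm, fun f hf => ?_⟩
  have hf' : f ∈ insert e M := Finset.mem_insert_of_mem hf
  have hne : f ≠ e := fun hh => h0 (hh ▸ hf)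
  obtain ⟨a, b, c, d⟩ := h.no_shared f hf' e hm hne
  exact ⟨a, c, b, d, h.no_cross e hm f hf' hne.symm⟩

noncomputable def cfg0 (P : Finset Pt) (hP : GenPos P) (M : Finset (Pt × Pt))
    (hM : IsMatching P M) : Cfg Pt (Pt × Pt) where
  P := P
  E := M
  X := Prod.fst
  lo := Prod.fst
  hi := Prod.snd
  S := SS
  ab := fun r f => yOn f r.1 < r.2
  Free := fun a b => FreeE P M (a, b)
  inj := by
    intro u hu v hv h
    by_contra hc
    exact hP.2 u hu v hv hc h
  loP := hM.left_mem
  hiP := hM.right_mem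
  lolo := by
    intro e he f hf h
    by_contra hc
    exact (hM.no_shared e he f hf hc).1 h
  hihi := by
    intro e he f hf h
    by_contra hc
    exact (hM.no_shared e he f hf hc).2.2.2 h
  freeL := by
    intro a b h
    have := h.facts
    exact ⟨this.1, fun e he => ⟨(this.2.2.2 e he).1, (this.2.2.2 e he).2.1⟩⟩
  freeR := by
    intro a b h
    have := h.facts
    exact ⟨this.2.1, fun e he => ⟨(this.2.2.2 e he).2.2.1, (this.2.2.2 e he).2.2.2.1⟩⟩
  freeLt := fun a b h => h.facts.2.2.1
  A1l := by
    intro a b h f hf h1 h2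
    have := h.facts
    have hab : a.1 < b.1 := this.2.2.1
    rw [SS_iff hab (hM.x_lt f hf) (this.2.2.2 f hf).2.2.2.2 le_rfl hab.le h1.le h2.le]
    have e : yOn (a, b) a.1 = a.2 := yOn_left (a, b)
    rw [e]
  A1r := by
    intro a b h f hf h1 h2
    have := h.facts
    have hab : a.1 < b.1 := this.2.2.1
    rw [SS_iff hab (hM.x_lt f hf) (this.2.2.2 f hf).2.2.2.2 hab.le le_rfl h1.le h2.le]
    have e : yOn (a, b) b.1 = b.2 := yOn_right (a, b) hab
    rw [e]
  A2 := by
    intro a b h e he f hf r hr h1 h2 h3 h4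
    have := h.facts
    have hab : a.1 < b.1 := this.2.2.1
    have hel := hM.x_lt e he
    have hy : e.1.1 ≤ r.1 ∧ r.1 ≤ e.2.1 ∧ yOn e r.1 = r.2 := by
      rcases hr with rfl | rfl
      · exact ⟨le_rfl, hel.le, yOn_left e⟩
      · exact ⟨hel.le, le_rfl, yOn_right e hel⟩
    rw [SS_iff hab (hM.x_lt f hf) (this.2.2.2 f hf).2.2.2.2 h1.le h2.le h3.le h4.le,
      SS_iff hab hel (this.2.2.2 e he).2.2.2.2 h1.le h2.le hy.1 hy.2.1, hy.2.2]
    intro hh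
    constructor
    · intro k
      by_contra hc
      have : yOn f r.1 < r.2 := by
        by_contra h9
        exact hc (hh.2 h9)
      push Not at hc
      linarith
    · intro k
      have := hh.1 k
      push Not at this
      linarith

theorem isMatching_empty (P : Finset Pt) : IsMatching P ∅ := by
  constructor <;> simp

theorem IsMatching.sub {P : Finset Pt} {M N : Finset (Pt × Pt)} (h : IsMatching P M)
    (hs : N ⊆ M) : IsMatching P N :=
  ⟨fun e he => h.left_mem e (hs he), fun e he => h.right_mem e (hs he),
    fun e he => h.x_lt e (hs he), fun e he f hf => h.no_shared e (hs he) f (hs hf),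
    fun e he f hf => h.no_cross e (hs he) f (hs hf)⟩

noncomputable def cfg (P : Finset Pt) (hP : GenPos P) (M : Finset (Pt × Pt)) :
    Cfg Pt (Pt × Pt) :=
  if h : IsMatching P M then cfg0 P hP M h else cfg0 P hP ∅ (isMatching_empty P)

theorem cfg_eq (P : Finset Pt) (hP : GenPos P) (M : Finset (Pt × Pt)) (h : IsMatching P M) :
    cfg P hP M = cfg0 P hP M h := dif_pos h

theorem iso_card (P : Finset Pt) (M : Finset (Pt × Pt)) (hM : IsMatching P M) :
    (P.filter fun p => Isolated M p).card + 2 * M.card = P.card := by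
  have h1 : (M.image Prod.fst).card = M.card := by
    apply Finset.card_image_of_injOn
    intro e he f hf h
    by_contra hc
    exact (hM.no_shared e he f hf hc).1 h
  have h2 : (M.image Prod.snd).card = M.card := by
    apply Finset.card_image_of_injOn
    intro e he f hf h
    by_contra hc
    exact (hM.no_shared e he f hf hc).2.2.2 h
  have h3 : Disjoint (M.image Prod.fst) (M.image Prod.snd) := by
    rw [Finset.disjoint_left]
    intro p hp hq
    obtain ⟨e, he, rfl⟩ := Finset.mem_image.1 hp
    obtain ⟨f, hf, h⟩ := Finset.mem_image.1 hq
    by_cases hc : e = f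
    · subst hc
      have := hM.x_lt e he
      rw [h] at this
      exact lt_irrefl _ this
    · exact (hM.no_shared e he f hf hc).2.1 h.symm
  have h4 : P.filter (fun p => ¬ Isolated M p) = M.image Prod.fst ∪ M.image Prod.snd := by
    ext p
    rw [Finset.mem_filter]
    simp only [Finset.mem_union, Finset.mem_image, Isolated]
    constructor
    · rintro ⟨_, h⟩
      push Not at h
      obtain ⟨e, he, h⟩ := h
      by_cases hc : e.1 = p
      · exact Or.inl ⟨e, he, hc⟩
      · exact Or.inr ⟨e, he, h hc⟩
    · rintro (⟨e, he, rfl⟩ | ⟨e, he, rfl⟩)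
      · exact ⟨hM.left_mem e he, fun h => (h e he).1 rfl⟩
      · exact ⟨hM.right_mem e he, fun h => (h e he).2 rfl⟩
  have h5 := Finset.card_filter_add_card_filter_not (s := P) (fun p => Isolated M p)
  rw [h4, Finset.card_union_of_disjoint h3, h1, h2] at h5
  omega

/-- visibility of `r` from the edge `e` of `M` -/
def EV (P : Finset Pt) (hP : GenPos P) (M : Finset (Pt × Pt)) (r : Pt) (e : Pt × Pt) : Prop :=
  (cfg P hP (M.erase e)).Vis e.1 e.2 r

theorem EV_iff (P : Finset Pt) (hP : GenPos P) (M : Finset (Pt × Pt)) (hM : IsMatching P M)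
    (r : Pt) (e : Pt × Pt) : EV P hP M r e ↔ e.1.1 < r.1 ∧ r.1 < e.2.1 ∧
      ∀ f ∈ M.erase e, (f.1.1 < r.1 ∧ r.1 < f.2.1) → (SS e.1 e.2 f ↔ yOn f r.1 < r.2) := by
  unfold EV
  rw [cfg_eq _ _ _ (hM.sub (Finset.erase_subset _ _))]
  rfl

theorem EV_aux (P : Finset Pt) (hP : GenPos P) (M : Finset (Pt × Pt)) (hM : IsMatching P M)
    (r : Pt) {e f : Pt × Pt} (he : e ∈ M) (hf : f ∈ M) (hne : e ≠ f) (h1 : EV P hP M r e)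
    (h2 : EV P hP M r f) : yOn f r.1 < yOn e r.1 ↔ yOn f r.1 < r.2 := by
  rw [EV_iff P hP M hM] at h1 h2
  have := h1.2.2 f (Finset.mem_erase.2 ⟨hne.symm, hf⟩) ⟨h2.1, h2.2.1⟩
  rw [← this, SS_iff (hM.x_lt e he) (hM.x_lt f hf) (hM.no_cross e he f hf hne) h1.1.le h1.2.1.le
    h2.1.le h2.2.1.le]

theorem EV_card (P : Finset Pt) (hP : GenPos P) (M : Finset (Pt × Pt)) (hM : IsMatching P M)
    (r : Pt) : (M.filter fun e => EV P hP M r e).card ≤ 2 := by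
  have h5 := Finset.card_filter_add_card_filter_not (s := M.filter fun e => EV P hP M r e)
    (fun e => yOn e r.1 < r.2)
  have key : ∀ e ∈ M, ∀ f ∈ M, EV P hP M r e → EV P hP M r f →
      (yOn e r.1 < r.2 ↔ yOn f r.1 < r.2) → e = f := by
    intro e he f hf h1 h2 h
    by_contra hne
    have a := EV_aux P hP M hM r he hf hne h1 h2
    have b := EV_aux P hP M hM r hf he (Ne.symm hne) h2 h1
    have i1 := (EV_iff P hP M hM r e).1 h1
    have i2 := (EV_iff P hP M hM r f).1 h2
    have c := yOn_ne (hM.x_lt e he) (hM.x_lt f hf) (hM.no_cross e he f hf hne) i1.1.le i1.2.1.le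
      i2.1.le i2.2.1.le
    rcases lt_or_gt_of_ne c with c | c
    · exact lt_asymm c (a.2 (h.1 (b.1 c)))
    · exact lt_asymm c (b.2 (h.2 (a.1 c)))
  have c1 : ((M.filter fun e => EV P hP M r e).filter (fun e => yOn e r.1 < r.2)).card ≤ 1 := by
    rw [Finset.card_le_one]
    intro e he f hf
    simp only [Finset.mem_filter] at he hf
    exact key e he.1.1 f hf.1.1 he.1.2 hf.1.2 (by tauto)
  have c2 : ((M.filter fun e => EV P hP M r e).filter (fun e => ¬ yOn e r.1 < r.2)).card ≤ 1 := by
    rw [Finset.card_le_one]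
    intro e he f hf
    simp only [Finset.mem_filter] at he hf
    exact key e he.1.1 f hf.1.1 he.1.2 hf.1.2 (by tauto)
  omega

theorem cost_edge (P : Finset Pt) (hP : GenPos P) (M : Finset (Pt × Pt)) (hM : IsMatching P M)
    (e : Pt × Pt) (he : e ∈ M) :
    (cfg P hP (M.erase e)).cost e.1 e.2 + (cfg P hP (M.erase e)).dual.cost e.2 e.1 ≤
      ∑ r ∈ P, if EV P hP M r e then (1 + if Isolated M r then 1 else 0) else 0 := by
  have hM' := hM.sub (Finset.erase_subset e M)
  have hPP : (cfg P hP (M.erase e)).P = P := by rw [cfg_eq _ _ _ hM']; rfl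
  have hPP' : (cfg P hP (M.erase e)).dual.P = P := hPP
  unfold Cfg.cost
  rw [hPP, hPP', Finset.card_filter, Finset.card_filter, ← Finset.sum_add_distrib]
  apply Finset.sum_le_sum
  intro r hr
  simp only [Cfg.dual_vis, Cfg.dual_iso]
  by_cases hv : EV P hP M r e
  · have hv' : (cfg P hP (M.erase e)).Vis e.1 e.2 r := hv
    simp only [hv, hv', and_true, if_true]
    by_cases hI : Isolated M r
    · rw [if_pos hI]
      split_ifs <;> omega
    · rw [if_neg hI]
      have i1 := (EV_iff P hP M hM r e).1 hv
      have n1 : e.1 ≠ r := by rintro rfl; exact lt_irrefl _ i1.1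
      have n2 : e.2 ≠ r := by rintro rfl; exact lt_irrefl _ i1.2.1
      have nI : ¬ (cfg P hP (M.erase e)).Iso r := by
        rw [cfg_eq _ _ _ hM']
        intro h
        apply hI
        intro f hf
        by_cases hc : f = e
        · subst hc; exact ⟨n1, n2⟩
        · exact h f (Finset.mem_erase.2 ⟨hc, hf⟩)
      have nn : ¬ ((cfg P hP (M.erase e)).Rt r ∧ (cfg P hP (M.erase e)).dual.Rt r) := by
        rw [cfg_eq _ _ _ hM']
        rintro ⟨⟨f, hf, h1⟩, ⟨f', hf', h2⟩⟩
        have h1 : f.2 = r := h1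
        have h2 : f'.1 = r := h2
        by_cases hc : f = f'
        · subst hc
          have := hM'.x_lt f hf
          rw [h1, h2] at this
          exact lt_irrefl _ this
        · exact (hM'.no_shared f hf f' hf' hc).2.2.1 (h1.trans h2.symm)
      by_cases k : (cfg P hP (M.erase e)).Rt r
      · have k' : ¬ (cfg P hP (M.erase e)).dual.Rt r := fun h => nn ⟨k, h⟩
        simp [nI, k, k']
      · simp only [nI, k, or_self, if_false, false_or]
        split_ifs <;> omega
  · have hv' : ¬ (cfg P hP (M.erase e)).Vis e.1 e.2 r := hv
    simp [hv, hv']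

theorem cost_total (P : Finset Pt) (hP : GenPos P) (M : Finset (Pt × Pt)) (hM : IsMatching P M) :
    ∑ e ∈ M, ((cfg P hP (M.erase e)).cost e.1 e.2 + (cfg P hP (M.erase e)).dual.cost e.2 e.1) ≤
      2 * (P.card + (P.filter fun p => Isolated M p).card) := by
  refine (Finset.sum_le_sum fun e he => cost_edge P hP M hM e he).trans ?_
  rw [Finset.sum_comm, Finset.card_eq_sum_ones, Finset.card_filter, ← Finset.sum_add_distrib,
    Finset.mul_sum]
  apply Finset.sum_le_sum
  intro r _
  rw [← Finset.sum_filter, Finset.sum_const, smul_eq_mul]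
  exact Nat.mul_le_mul_right _ (EV_card P hP M hM r)

noncomputable def gg (P : Finset Pt) (hP : GenPos P) (M : Finset (Pt × Pt)) (e : Pt × Pt) : ℕ :=
  (cfg P hP M).g ((cfg P hP M).dual.LI e.2) e +
    (cfg P hP M).dual.g ((cfg P hP M).LI e.1) (e.2, e.1)

theorem gg_lower (P : Finset Pt) (hP : GenPos P) (M : Finset (Pt × Pt)) (hM : IsMatching P M) :
    160 * M.card ≤ ∑ e ∈ M, gg P hP (M.erase e) e +
      16 * (2 * (P.card + (P.filter fun p => Isolated M p).card)) := by
  have h1 : M.card * 160 ≤ ∑ e ∈ M, (gg P hP (M.erase e) e + 16 *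
      ((cfg P hP (M.erase e)).cost e.1 e.2 + (cfg P hP (M.erase e)).dual.cost e.2 e.1)) := by
    rw [← smul_eq_mul]
    apply Finset.card_nsmul_le_sum
    intro e _
    exact Cfg.g_pair _ e.1 e.2
  rw [Finset.sum_add_distrib, ← Finset.mul_sum] at h1
  have := cost_total P hP M hM
  omega

theorem gg_upper (P : Finset Pt) (hP : GenPos P) (M : Finset (Pt × Pt)) (hM : IsMatching P M) :
    ∑ e ∈ (P ×ˢ P).filter (fun e => FreeE P M e), gg P hP M e ≤
      712 * (P.filter fun p => Isolated M p).card := by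
  have := (cfg P hP M).total_sum
  have e1 : (cfg P hP M).fs = (P ×ˢ P).filter (fun e => FreeE P M e) := by
    ext e
    rw [Cfg.mem_fs, Finset.mem_filter, Finset.mem_product, cfg_eq _ _ _ hM]
    exact ⟨fun h => ⟨⟨h.facts.1, h.facts.2.1⟩, h⟩, fun h => h.2⟩
  have e2 : (cfg P hP M).iso = P.filter fun p => Isolated M p := by
    ext e
    rw [Cfg.iso, Finset.mem_filter, Finset.mem_filter, cfg_eq _ _ _ hM]
    rfl
  rw [e1, e2] at this
  exact this

theorem double_count (P : Finset Pt) (m : ℕ) (hm : 1 ≤ m)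
    (F : Finset (Pt × Pt) → Pt × Pt → ℕ) :
    ∑ M ∈ Matchings P m, ∑ e ∈ M, F (M.erase e) e =
      ∑ M ∈ Matchings P (m - 1), ∑ e ∈ (P ×ˢ P).filter (fun e => FreeE P M e), F M e := by
  rw [Finset.sum_sigma', Finset.sum_sigma']
  refine Finset.sum_bij' (fun x _ => ⟨x.1.erase x.2, x.2⟩) (fun x _ => ⟨insert x.2 x.1, x.2⟩)
    ?_ ?_ ?_ ?_ ?_
  · rintro ⟨M, e⟩ h
    simp only [Finset.mem_sigma, mem_Matchings] at h
    obtain ⟨⟨h1, h2⟩, h3⟩ := h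
    simp only [Finset.mem_sigma, mem_Matchings, Finset.mem_filter, Finset.mem_product]
    refine ⟨⟨h1.sub (Finset.erase_subset _ _), ?_⟩, ⟨h1.left_mem e h3, h1.right_mem e h3⟩, ?_, ?_⟩
    · rw [Finset.card_erase_of_mem h3, h2]
    · exact Finset.notMem_erase e M
    · rw [Finset.insert_erase h3]
      exact h1
  · rintro ⟨M, e⟩ h
    simp only [Finset.mem_sigma, mem_Matchings, Finset.mem_filter, Finset.mem_product] at h
    obtain ⟨⟨h1, h2⟩, _, h3, h4⟩ := h
    simp only [Finset.mem_sigma, mem_Matchings]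
    refine ⟨⟨h4, ?_⟩, Finset.mem_insert_self _ _⟩
    rw [Finset.card_insert_of_notMem h3]
    omega
  · rintro ⟨M, e⟩ h
    simp only [Finset.mem_sigma] at h
    simp only [Finset.insert_erase h.2]
  · rintro ⟨M, e⟩ h
    simp only [Finset.mem_sigma, Finset.mem_filter] at h
    simp only [Finset.erase_insert h.2.2.1]
  · rintro ⟨M, e⟩ h
    rfl


/-- For every integer `m ≥ 1`, writing `s = n − 2m`,
one has `(3n − 7s)·Ma_m(P) ≤ (89/2)·(s + 2)·Ma_{m−1}(P)`. -/
theorem Ma_recurrence_five_improved (P : Finset Pt) (hP : GenPos P)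
    (m : ℕ) (hm : 1 ≤ m) :
    (3 * (P.card : ℚ) - 7 * ((P.card : ℚ) - 2 * m)) * Ma P m ≤
      (89 / 2) * (((P.card : ℚ) - 2 * m) + 2) * Ma P (m - 1) := by
  have hd := double_count P m hm (gg P hP)
  have hlow : (Ma P m : ℚ) * (160 * m - 32 * (2 * P.card - 2 * m)) ≤
      ((∑ M ∈ Matchings P m, ∑ e ∈ M, gg P hP (M.erase e) e : ℕ) : ℚ) := by
    unfold Ma
    rw [← nsmul_eq_mul, Nat.cast_sum]
    apply Finset.card_nsmul_le_sum
    intro M hM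
    rw [mem_Matchings] at hM
    have h1 := gg_lower P hP M hM.1
    have h2 := iso_card P M hM.1
    rw [hM.2] at h1 h2
    have h1' : (160 * m : ℚ) ≤ ((∑ e ∈ M, gg P hP (M.erase e) e : ℕ) : ℚ) +
      16 * (2 * (P.card + (P.filter fun p => Isolated M p).card)) := by exact_mod_cast h1
    have h2' : ((P.filter fun p => Isolated M p).card : ℚ) + 2 * m = P.card := by
      exact_mod_cast h2
    linarith
  have hup : ((∑ M ∈ Matchings P (m - 1), ∑ e ∈ (P ×ˢ P).filter (fun e => FreeE P M e),
      gg P hP M e : ℕ) : ℚ) ≤ (Ma P (m - 1) : ℚ) * (712 * (P.card - 2 * m + 2)) := by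
    unfold Ma
    rw [← nsmul_eq_mul, Nat.cast_sum]
    apply Finset.sum_le_card_nsmul
    intro M hM
    rw [mem_Matchings] at hM
    have h1 := gg_upper P hP M hM.1
    have h2 := iso_card P M hM.1
    have h3 : M.card + 1 = m := by omega
    have h1' : ((∑ e ∈ (P ×ˢ P).filter (fun e => FreeE P M e), gg P hP M e : ℕ) : ℚ) ≤
      712 * (P.filter fun p => Isolated M p).card := by exact_mod_cast h1
    have h2' : ((P.filter fun p => Isolated M p).card : ℚ) + 2 * M.card = P.card := by
      exact_mod_cast h2
    have h3' : (M.card : ℚ) + 1 = m := by exact_mod_cast h3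
    have : (P.card : ℚ) - 2 * m + 2 = (P.filter fun p => Isolated M p).card := by linarith
    rw [this]
    exact h1'
  rw [hd] at hlow
  nlinarith [hlow.trans hup]
end
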